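/- Let π = (λ_1, λ_2, …, λ_s ; 0 = a_0, a_1, …, a_{s−1}, a_s = 1) be a Generalized Lakshmibai–Seshadri path of shape λ ∈ P^+, let i ∈ I^{im} and suppose f_iπ ≠ 0. Then f_+^i(π) = 0 and, with p (1 ≤ p ≤ s) such that a_{p−1} < f_-^i(π) ≤ a_p, one has f_iπ = (r_iλ_1, …, r_iλ_p, λ_p, …, λ_s ; a_0, a_1, …, a_{p−1}, f_-^i(π), a_p, …, a_s), with α_i^∨(λ_j) = α_i^∨(λ_{j+1}) for all 1 ≤ j ≤ p−1, and f_iπ is again a Generalized Lakshmibai–Seshadri path of shape λ. In particular ℙ_λ is stable under f_i for all i ∈ I^{im}. -/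

import Mathlib

namespace GKM

variable {I V : Type*} [AddCommGroup V] [Module ℚ V]

/-- The simple "reflection" `r_i : x ↦ x - α_i^∨(x) • α_i` (an endomorphism of `h*`). -/
def srefl (α : I → V) (coroot : I → (V →ₗ[ℚ] ℚ)) (i : I) : Module.End ℚ V :=
  LinearMap.id - (coroot i).smulRight (α i)

/-- The dual map `h ↦ h - h(α_i) • α_i^∨` on linear functionals; for a real index `i`
this is `r_i^∨ : h ↦ h ∘ r_i⁻¹ = h ∘ r_i`. -/
def crefl (α : I → V) (coroot : I → (V →ₗ[ℚ] ℚ)) (i : I) :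
    Module.End ℚ (V →ₗ[ℚ] ℚ) :=
  LinearMap.id - (LinearMap.applyₗ (α i)).smulRight (coroot i)

/-- The monoid `T` generated by all the `r_i`, `i ∈ I`. -/
def Tmon (α : I → V) (coroot : I → (V →ₗ[ℚ] ℚ)) : Submonoid (Module.End ℚ V) :=
  Submonoid.closure (Set.range (srefl α coroot))

/-- The Weyl group `W` generated by the `r_i` with `i` real; since each generator is an
involution, the submonoid it generates coincides with the group it generates. -/
def Wmon (A : I → I → ℤ) (α : I → V) (coroot : I → (V →ₗ[ℚ] ℚ)) :
    Submonoid (Module.End ℚ V) :=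
  Submonoid.closure (srefl α coroot '' {i | A i i = 2})

/-- `Q^+`, the set of `ℕ`-linear combinations of simple roots. -/
def Qplus (α : I → V) : Set V :=
  {x | ∃ c : I →₀ ℕ, x = c.sum fun i n => (n : ℚ) • α i}

/-- The weight lattice `P`. -/
def Pint (coroot : I → (V →ₗ[ℚ] ℚ)) : Set V :=
  {x | ∀ i, ∃ n : ℤ, coroot i x = (n : ℚ)}

/-- The dominant integral weights `P^+`. -/
def Pplus (coroot : I → (V →ₗ[ℚ] ℚ)) : Set V :=
  {x | (∀ i, ∃ n : ℤ, coroot i x = (n : ℚ)) ∧ ∀ i, 0 ≤ coroot i x}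

/-- The orbit `Tλ`. -/
def Torbit (α : I → V) (coroot : I → (V →ₗ[ℚ] ℚ)) (lam : V) : Set V :=
  {x | ∃ τ, τ ∈ Tmon α coroot ∧ τ lam = x}

/-- The reduced length of `τ ∈ T` with respect to all generators `r_i`, `i ∈ I`. -/
noncomputable def lenT (α : I → V) (coroot : I → (V →ₗ[ℚ] ℚ))
    (τ : Module.End ℚ V) : ℕ :=
  sInf {n | ∃ l : List I, l.length = n ∧ (l.map (srefl α coroot)).prod = τ}

/-- The reduced length of `w ∈ W` with respect to the real generators. -/
noncomputable def lenW (A : I → I → ℤ) (α : I → V) (coroot : I → (V →ₗ[ℚ] ℚ))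
    (w : Module.End ℚ V) : ℕ :=
  sInf {n | ∃ l : List I, (∀ m ∈ l, A m m = 2) ∧ l.length = n ∧
    (l.map (srefl α coroot)).prod = w}

/-- The reflection `r_β : x ↦ x - β^∨(x) • β` attached to a root/coroot pair. -/
def reflRoot (β : V) (βv : V →ₗ[ℚ] ℚ) : Module.End ℚ V :=
  LinearMap.id - βv.smulRight β

/-- A presentation of `β = w α_k ∈ WΠ` together with its coroot `β^∨ = w^∨ α_k^∨`,
via a word `l` (with real entries) for `w`. -/
def IsWRootPres (A : I → I → ℤ) (α : I → V) (coroot : I → (V →ₗ[ℚ] ℚ))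
    (l : List I) (k : I) (β : V) (βv : V →ₗ[ℚ] ℚ) : Prop :=
  (∀ m ∈ l, A m m = 2) ∧
  β = (l.map (srefl α coroot)).prod (α k) ∧
  βv = (l.map (crefl α coroot)).prod (coroot k)

/-- `β ∈ WΠ` with coroot `β^∨`. -/
def IsWRootPair (A : I → I → ℤ) (α : I → V) (coroot : I → (V →ₗ[ℚ] ℚ))
    (β : V) (βv : V →ₗ[ℚ] ℚ) : Prop :=
  ∃ l k, IsWRootPres A α coroot l k β βv

/-- A chain `ν =: c s ← ⋯ ← c 0 := μ` of length `s` inside `Tλ`: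
`c k = r_{β k} (c (k+1))` with `β k ∈ WΠ ∩ Q^+` and `(β k)^∨(c (k+1)) > 0`. -/
def IsChain (A : I → I → ℤ) (α : I → V) (coroot : I → (V →ₗ[ℚ] ℚ))
    (lam μ ν : V) (s : ℕ) (c : ℕ → V) (β : ℕ → V)
    (βv : ℕ → (V →ₗ[ℚ] ℚ)) : Prop :=
  c 0 = μ ∧ c s = ν ∧ (∀ k ≤ s, c k ∈ Torbit α coroot lam) ∧
  ∀ k < s, IsWRootPair A α coroot (β k) (βv k) ∧ β k ∈ Qplus α ∧
    0 < βv k (c (k+1)) ∧ c k = c (k+1) - βv k (c (k+1)) • β k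

/-- `μ > ν` in `Tλ`. -/
def ChainGT (A : I → I → ℤ) (α : I → V) (coroot : I → (V →ₗ[ℚ] ℚ))
    (lam μ ν : V) : Prop :=
  ∃ s, 1 ≤ s ∧ ∃ c β βv, IsChain A α coroot lam μ ν s c β βv

/-- `dist(μ, ν) = n`: there is a chain of length `n` from `μ` to `ν` and every chain
has length at most `n`. -/
def distEq (A : I → I → ℤ) (α : I → V) (coroot : I → (V →ₗ[ℚ] ℚ))
    (lam μ ν : V) (n : ℕ) : Prop :=
  (∃ c β βv, IsChain A α coroot lam μ ν n c β βv) ∧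
  ∀ m c β βv, IsChain A α coroot lam μ ν m c β βv → m ≤ n

/-- An `a`-chain for `(μ, ν)`: a chain in which each step is a covering
(`dist = 1`), `a·β_k^∨(ν_k)` is a positive integer for steps along `WΠ_re`,
and `a·β_k^∨(ν_k) = 1` for steps along `WΠ_im`.  The index `ks k` records the simple
root of which `β k` is a `W`-translate. -/
def IsAChain (A : I → I → ℤ) (α : I → V) (coroot : I → (V →ₗ[ℚ] ℚ))
    (lam : V) (a : ℚ) (μ ν : V) (s : ℕ) (c : ℕ → V)
    (β : ℕ → V) (βv : ℕ → (V →ₗ[ℚ] ℚ)) (ks : ℕ → I) : Prop :=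
  1 ≤ s ∧ IsChain A α coroot lam μ ν s c β βv ∧
  ∀ k < s,
    (∃ l, IsWRootPres A α coroot l (ks k) (β k) (βv k)) ∧
    distEq A α coroot lam (c k) (c (k+1)) 1 ∧
    (A (ks k) (ks k) = 2 → ∃ n : ℕ, 0 < n ∧ a * βv k (c (k+1)) = (n : ℚ)) ∧
    (A (ks k) (ks k) ≠ 2 → a * βv k (c (k+1)) = 1)

/-- Existence of an `a`-chain for `(μ, ν)`. -/
def HasAChain (A : I → I → ℤ) (α : I → V) (coroot : I → (V →ₗ[ℚ] ℚ))
    (lam : V) (a : ℚ) (μ ν : V) : Prop :=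
  ∃ s c β βv ks, IsAChain A α coroot lam a μ ν s c β βv ks

/-- The piecewise-linear path attached to GLS data `(λ_1, …, λ_s ; a_0, …, a_s)`
(weights indexed `1, …, s`, breakpoints indexed `0, …, s`):
on `[a_{j-1}, a_j]` it equals `Σ_{k<j} (a_k - a_{k-1}) • λ_k + (t - a_{j-1}) • λ_j`. -/
def glsPath (lamseq : ℕ → V) (a : ℕ → ℚ) (s : ℕ) (t : ℚ) : V :=
  ∑ k ∈ Finset.range s, (max (min t (a (k+1)) - a k) 0) • lamseq (k+1)

/-- The data of a Generalized Lakshmibai–Seshadri path of shape `lam`. -/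
def IsGLS (A : I → I → ℤ) (α : I → V) (coroot : I → (V →ₗ[ℚ] ℚ))
    (lam : V) (s : ℕ) (lamseq : ℕ → V) (a : ℕ → ℚ) : Prop :=
  1 ≤ s ∧ a 0 = 0 ∧ a s = 1 ∧ (∀ k < s, a k < a (k+1)) ∧
  (∀ k, 1 ≤ k → k ≤ s → lamseq k ∈ Torbit α coroot lam) ∧
  (∀ k, 1 ≤ k → k < s →
    HasAChain A α coroot lam (a k) (lamseq k) (lamseq (k+1))) ∧
  (lamseq s = lam ∨ HasAChain A α coroot lam 1 (lamseq s) lam)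

/-- The set `ℙ_λ` of Generalized Lakshmibai–Seshadri paths of shape `lam`,
realized as functions `ℚ → V` via `glsPath`. -/
def GLSset (A : I → I → ℤ) (α : I → V) (coroot : I → (V →ₗ[ℚ] ℚ))
    (lam : V) : Set (ℚ → V) :=
  {π | ∃ s lamseq a, IsGLS A α coroot lam s lamseq a ∧ π = glsPath lamseq a s}

/-- `h_i^π(t) = α_i^∨(π(t))`. -/
def hFun (coroot : I → (V →ₗ[ℚ] ℚ)) (i : I) (π : ℚ → V) (t : ℚ) : ℚ :=
  coroot i (π t)

/-- `m_i^π`, the minimal integer value attained by `h_i^π` on `[0,1]`. -/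
noncomputable def mOf (coroot : I → (V →ₗ[ℚ] ℚ)) (i : I) (π : ℚ → V) : ℤ :=
  sInf {n : ℤ | ∃ t, 0 ≤ t ∧ t ≤ 1 ∧ hFun coroot i π t = (n : ℚ)}

/-- Two paths agree on `[0,1]`. -/
def pathEq (π π' : ℚ → V) : Prop := ∀ t, 0 ≤ t → t ≤ 1 → π t = π' t

/-- `tp = f_+^i(π)`: the largest point of `[0,1]` where `h_i^π` equals `m_i^π`. -/
def IsFPlus (coroot : I → (V →ₗ[ℚ] ℚ)) (i : I) (π : ℚ → V) (tp : ℚ) : Prop :=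
  0 ≤ tp ∧ tp ≤ 1 ∧ hFun coroot i π tp = (mOf coroot i π : ℚ) ∧
  ∀ t, 0 ≤ t → t ≤ 1 → hFun coroot i π t = (mOf coroot i π : ℚ) → t ≤ tp

/-- `tm = f_-^i(π)`: the smallest point of `[tp,1]` where `h_i^π` equals `m_i^π + 1`. -/
def IsFMinus (coroot : I → (V →ₗ[ℚ] ℚ)) (i : I) (π : ℚ → V) (tp tm : ℚ) : Prop :=
  tp ≤ tm ∧ tm ≤ 1 ∧ hFun coroot i π tm = (mOf coroot i π : ℚ) + 1 ∧
  ∀ t, tp ≤ t → t ≤ 1 → hFun coroot i π t = (mOf coroot i π : ℚ) + 1 → tm ≤ t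

/-- The path `f_i π` (for cutting data `tp = f_+^i(π)`, `tm = f_-^i(π)`). -/
def fPath (α : I → V) (coroot : I → (V →ₗ[ℚ] ℚ)) (i : I) (tp tm : ℚ)
    (π : ℚ → V) (t : ℚ) : V :=
  if t ≤ tp then π t
  else if t ≤ tm then π tp + srefl α coroot i (π t - π tp)
  else π t - α i

/-- `π' = f_i π ≠ 0` (equality of paths on `[0,1]`). -/
def FRel (α : I → V) (coroot : I → (V →ₗ[ℚ] ℚ)) (i : I) (π π' : ℚ → V) : Prop :=
  ∃ tp tm, IsFPlus coroot i π tp ∧ tp < 1 ∧ IsFMinus coroot i π tp tm ∧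
    pathEq π' (fPath α coroot i tp tm π)

/-- `tp = e_+^i(π)` (`i` real): smallest point of `[0,1]` where `h_i^π = m_i^π`. -/
def IsEPlusRe (coroot : I → (V →ₗ[ℚ] ℚ)) (i : I) (π : ℚ → V) (tp : ℚ) : Prop :=
  0 ≤ tp ∧ tp ≤ 1 ∧ hFun coroot i π tp = (mOf coroot i π : ℚ) ∧
  ∀ t, 0 ≤ t → t ≤ 1 → hFun coroot i π t = (mOf coroot i π : ℚ) → tp ≤ t

/-- `tm = e_-^i(π)` (`i` real): largest point of `[0,tp]` where `h_i^π = m_i^π + 1`. -/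
def IsEMinusRe (coroot : I → (V →ₗ[ℚ] ℚ)) (i : I) (π : ℚ → V) (tp tm : ℚ) : Prop :=
  0 ≤ tm ∧ tm ≤ tp ∧ hFun coroot i π tm = (mOf coroot i π : ℚ) + 1 ∧
  ∀ t, 0 ≤ t → t ≤ tp → hFun coroot i π t = (mOf coroot i π : ℚ) + 1 → t ≤ tm

/-- The path `e_i π` for `i` real. -/
def ePathRe (α : I → V) (coroot : I → (V →ₗ[ℚ] ℚ)) (i : I) (tm tp : ℚ)
    (π : ℚ → V) (t : ℚ) : V :=
  if t ≤ tm then π t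
  else if t ≤ tp then π tm + srefl α coroot i (π t - π tm)
  else π t + α i

/-- `π' = e_i π ≠ 0` for a real index `i`. -/
def ERelRe (α : I → V) (coroot : I → (V →ₗ[ℚ] ℚ)) (i : I) (π π' : ℚ → V) : Prop :=
  ∃ tp tm, IsEPlusRe coroot i π tp ∧ 0 < tp ∧ IsEMinusRe coroot i π tp tm ∧
    pathEq π' (ePathRe α coroot i tm tp π)

/-- The "inverse reflection" `r_i^{-1} : x ↦ x + (1/(1-a_{ii})) α_i^∨(x) α_i`
for an imaginary index `i`. -/
def rinv (A : I → I → ℤ) (α : I → V) (coroot : I → (V →ₗ[ℚ] ℚ)) (i : I) :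
    Module.End ℚ V :=
  LinearMap.id + (1 / (1 - (A i i : ℚ))) • (coroot i).smulRight (α i)

/-- `tp = e_+^i(π)` (`i` imaginary): smallest point of `[tm,1]` where
`h_i^π = m_i^π + 1 - a_{ii}` (here `tm = e_-^i(π) = f_+^i(π)`). -/
def IsEPlusIm (A : I → I → ℤ) (coroot : I → (V →ₗ[ℚ] ℚ)) (i : I) (π : ℚ → V)
    (tm tp : ℚ) : Prop :=
  tm ≤ tp ∧ tp ≤ 1 ∧
  hFun coroot i π tp = (mOf coroot i π : ℚ) + 1 - (A i i : ℚ) ∧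
  ∀ t, tm ≤ t → t ≤ 1 →
    hFun coroot i π t = (mOf coroot i π : ℚ) + 1 - (A i i : ℚ) → tp ≤ t

/-- The path `e_i π` for `i` imaginary. -/
def ePathIm (A : I → I → ℤ) (α : I → V) (coroot : I → (V →ₗ[ℚ] ℚ)) (i : I)
    (tm tp : ℚ) (π : ℚ → V) (t : ℚ) : V :=
  if t ≤ tm then π t
  else if t ≤ tp then π tm + rinv A α coroot i (π t - π tm)
  else π t + α i

/-- `π' = e_i π ≠ 0` for an imaginary index `i`:  `e_-^i(π) = f_+^i(π) < 1`, the point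
`e_+^i(π)` exists, and `h_i^π` never drops to `m_i^π - a_{ii}` on `[e_+^i(π), 1]`. -/
def ERelIm (A : I → I → ℤ) (α : I → V) (coroot : I → (V →ₗ[ℚ] ℚ)) (i : I)
    (π π' : ℚ → V) : Prop :=
  ∃ tm tp, IsFPlus coroot i π tm ∧ tm < 1 ∧ IsEPlusIm A coroot i π tm tp ∧
    (∀ t, tp ≤ t → t ≤ 1 →
      (mOf coroot i π : ℚ) - (A i i : ℚ) < hFun coroot i π t) ∧
    pathEq π' (ePathIm A α coroot i tm tp π)

/-- `π' = e_i π ≠ 0`. -/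
def ERel (A : I → I → ℤ) (α : I → V) (coroot : I → (V →ₗ[ℚ] ℚ)) (i : I)
    (π π' : ℚ → V) : Prop :=
  (A i i = 2 ∧ ERelRe α coroot i π π') ∨ (A i i ≠ 2 ∧ ERelIm A α coroot i π π')

/-- `π' = f_{i_1} ⋯ f_{i_k} π ≠ 0` for a list `[i_1, …, i_k]` (rightmost acts first). -/
def FMonRel (α : I → V) (coroot : I → (V →ₗ[ℚ] ℚ)) :
    List I → (ℚ → V) → (ℚ → V) → Prop
  | [], π, π' => pathEq π π'
  | i :: l, π, π' => ∃ πm, FMonRel α coroot l π πm ∧ FRel α coroot i πm π'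

/-- A generalized crystal for the Borcherds–Cartan datum `(A, α, coroot)`. -/
structure GenCrystal (A : I → I → ℤ) (α : I → V)
    (coroot : I → (V →ₗ[ℚ] ℚ)) where
  B : Type*
  wt : B → V
  wt_int : ∀ (i : I) (b : B), ∃ n : ℤ, coroot i (wt b) = (n : ℚ)
  eps : I → B → WithBot ℤ
  phi : I → B → WithBot ℤ
  e : I → B → Option B
  f : I → B → Option B
  phi_eq : ∀ (i : I) (b : B) (n : ℤ), (n : ℚ) = coroot i (wt b) →
    phi i b = eps i b + (n : WithBot ℤ)
  wt_e : ∀ (i : I) (b b' : B), e i b = some b' → wt b' = wt b + α i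
  eps_e_re : ∀ (i : I) (b b' : B), A i i = 2 → e i b = some b' →
    eps i b' = eps i b + ((-1 : ℤ) : WithBot ℤ)
  eps_e_im : ∀ (i : I) (b b' : B), A i i ≠ 2 → e i b = some b' →
    eps i b' = eps i b
  e_iff_f : ∀ (i : I) (b b' : B), e i b = some b' ↔ f i b' = some b
  phi_bot : ∀ (i : I) (b : B), phi i b = ⊥ → e i b = none ∧ f i b = none
  eps_im : ∀ (i : I) (b : B), A i i ≠ 2 → eps i b ≤ 0
  phi_im : ∀ (i : I) (b : B), A i i ≠ 2 → phi i b = ⊥ ∨ 0 ≤ phi i b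

/-- Finite "orthogonal" subsets of the imaginary simple roots, encoded by their
index sets: `F ∈ 𝒫(Π_im)`. -/
def PImSet (A : I → I → ℤ) (F : Finset I) : Prop :=
  (∀ i ∈ F, A i i ≠ 2) ∧ ∀ i ∈ F, ∀ j ∈ F, i ≠ j → A i j = 0

end GKM

namespace GKM

open CoxeterSystem

section Realization

variable {I M : Type*} [AddCommGroup M] [Module ℚ M]

theorem srefl_apply (e : I → M) (f : I → (M →ₗ[ℚ] ℚ)) (i : I) (x : M) :
    srefl e f i x = x - f i x • e i := by
  simp [srefl]

/-- The order of `r_s r_t` when `a_{st} a_{ts} = n`, with `0` standing for infinity. -/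
def bondOrder (n : ℤ) : ℕ :=
  if n = 0 then 2 else if n = 1 then 3 else if n = 2 then 4 else if n = 3 then 6 else 0

open Classical in
/-- The Coxeter matrix of the Weyl group of a Borcherds-Cartan matrix. -/
noncomputable def weylMatrix (A : I → I → ℤ) : CoxeterMatrix {i // A i i = 2} where
  M := Matrix.of fun s t => if s = t then 1 else bondOrder (A s t * A t s)
  isSymm := by
    ext s t
    simp [Matrix.transpose_apply, eq_comm, mul_comm]
  diagonal s := by simp
  off_diagonal s t h := by
    simp only [Matrix.of_apply, h, if_false, bondOrder]
    split_ifs <;> simp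

theorem weylMatrix_of_ne (A : I → I → ℤ) {s t : {i // A i i = 2}} (h : s ≠ t) :
    weylMatrix A s t = bondOrder (A s t * A t s) := by
  simp [weylMatrix, h]

/-- Vectors `e` and functionals `f` with `f i (e j) = B i j`, together with coordinate
functionals `δ` for `e`, where `B` is a Borcherds-Cartan matrix whose Weyl group has the same
Coxeter matrix as that of `A`. -/
structure IsRealization (A B : I → I → ℤ) (e : I → M) (f δ : I → (M →ₗ[ℚ] ℚ)) : Prop where
  pair : ∀ i j, f i (e j) = (B i j : ℚ)
  diag : ∀ i, B i i = A i i
  bond : ∀ i j, B i j * B j i = A i j * A j i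
  off : ∀ i j, i ≠ j → B i j ≤ 0
  zero : ∀ i j, B i j = 0 → B j i = 0
  coord_self : ∀ i, δ i (e i) = 1
  coord_ne : ∀ i j, i ≠ j → δ i (e j) = 0

theorem eq_of_mul_mem_one_two_three {a b : ℤ} (ha : a ≤ 0) (hb : b ≤ 0)
    (h : a * b = 1 ∨ a * b = 2 ∨ a * b = 3) :
    (a = -1 ∧ b = -1) ∨ (a = -1 ∧ b = -2) ∨ (a = -2 ∧ b = -1) ∨ (a = -1 ∧ b = -3) ∨
      (a = -3 ∧ b = -1) := by
  have ha' : -3 ≤ a := by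
    by_contra! hlt
    rcases hb.lt_or_eq with hb | rfl
    · have : 0 ≤ (-a - 4) * (-b - 1) := mul_nonneg (by omega) (by omega)
      rcases h with h | h | h <;> nlinarith
    · simp at h
  have hb' : -3 ≤ b := by
    by_contra! hlt
    rcases ha.lt_or_eq with ha | rfl
    · have : 0 ≤ (-a - 1) * (-b - 4) := mul_nonneg (by omega) (by omega)
      rcases h with h | h | h <;> nlinarith
    · simp at h
  interval_cases a <;> interval_cases b <;> simp_all

/-- The coefficients of `x`-translates under `r_s r_t`, where `F`, `G` are the values of the
two coroots at `x`. -/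
def rotateCoeff (a b F G : ℚ) (c : ℚ × ℚ) : ℚ × ℚ :=
  let q := -c.2 - G - c.1 * b
  (-c.1 - F - q * a, q)

theorem srefl_mul_pow_apply {e : I → M} {f : I → (M →ₗ[ℚ] ℚ)} {s t : I}
    (hs : f s (e s) = 2) (ht : f t (e t) = 2) (x : M) (m : ℕ) :
    ((srefl e f s * srefl e f t) ^ m) x =
      x + ((rotateCoeff (f s (e t)) (f t (e s)) (f s x) (f t x))^[m] (0, 0)).1 • e s +
        ((rotateCoeff (f s (e t)) (f t (e s)) (f s x) (f t x))^[m] (0, 0)).2 • e t := by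
  induction m with
  | zero => simp
  | succ m ih =>
    rw [pow_succ', Module.End.mul_apply, ih, Function.iterate_succ_apply']
    generalize (rotateCoeff (f s (e t)) (f t (e s)) (f s x) (f t x))^[m] (0, 0) = c
    simp only [Module.End.mul_apply, srefl_apply, map_add, map_sub, map_smul, hs, ht,
      rotateCoeff]
    module

theorem isLiftable_srefl {A B : I → I → ℤ} {e : I → M} {f δ : I → (M →ₗ[ℚ] ℚ)}
    (h : IsRealization A B e f δ) :
    (weylMatrix A).IsLiftable fun s => srefl e f s.1 := by
  intro s t
  have hs : f s (e s) = 2 := by rw [h.pair, h.diag, s.2]; rfl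
  have ht : f t (e t) = 2 := by rw [h.pair, h.diag, t.2]; rfl
  by_cases hst : s = t
  · subst hst
    ext x
    simp only [CoxeterMatrix.diagonal, pow_one, Module.End.mul_apply, srefl_apply, map_sub,
      map_smul, hs, Module.End.one_apply]
    module
  have hne : s.1 ≠ t.1 := fun h' => hst (Subtype.ext h')
  ext x
  rw [srefl_mul_pow_apply hs ht, weylMatrix_of_ne A hst, ← h.bond, h.pair, h.pair]
  have key : (rotateCoeff (B s t) (B t s) (f s x) (f t x))^[bondOrder (B s t * B t s)] (0, 0)
      = (0, 0) := by
    have h0 := h.zero s t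
    have h0' := h.zero t s
    have ha := h.off s t hne
    have hb := h.off t s hne.symm
    generalize f s x = F
    generalize f t x = G
    generalize B s t = a at *
    generalize B t s = b at *
    by_cases hab : a * b = 0
    · have ha0 : a = 0 := by rcases mul_eq_zero.1 hab with h | h <;> simp_all
      have hb0 : b = 0 := h0 ha0
      subst ha0 hb0
      simp [bondOrder, rotateCoeff]
    by_cases hab' : a * b = 1 ∨ a * b = 2 ∨ a * b = 3
    · rcases eq_of_mul_mem_one_two_three ha hb hab' with h | h | h | h | h <;>
        obtain ⟨rfl, rfl⟩ := h <;>
        norm_num [bondOrder, rotateCoeff] <;> constructor <;> ring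
    · push Not at hab'
      simp [bondOrder, hab, hab']
  rw [key]
  simp

/-- The action of the Weyl group on a realization. -/
noncomputable def weylRep {A B : I → I → ℤ} {e : I → M} {f δ : I → (M →ₗ[ℚ] ℚ)}
    (h : IsRealization A B e f δ) : (weylMatrix A).Group →* Module.End ℚ M :=
  (weylMatrix A).toCoxeterSystem.lift ⟨_, isLiftable_srefl h⟩

theorem weylRep_simple {A B : I → I → ℤ} {e : I → M} {f δ : I → (M →ₗ[ℚ] ℚ)}
    (h : IsRealization A B e f δ) (s : {i // A i i = 2}) :
    weylRep h ((weylMatrix A).toCoxeterSystem.simple s) = srefl e f s.1 :=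
  (weylMatrix A).toCoxeterSystem.lift_apply_simple (isLiftable_srefl h) s

theorem weylRep_simple_apply {A B : I → I → ℤ} {e : I → M} {f δ : I → (M →ₗ[ℚ] ℚ)}
    (h : IsRealization A B e f δ) (s : {i // A i i = 2}) (x : M) :
    weylRep h ((weylMatrix A).toCoxeterSystem.simple s) x = x - f s x • e s := by
  rw [weylRep_simple, srefl_apply]

/-- The cone of nonnegative rational combinations of the vectors `e i`. -/
def posCone (e : I → M) : AddSubmonoid M :=
  AddSubmonoid.closure {x | ∃ q : ℚ, 0 ≤ q ∧ ∃ i, x = q • e i}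

theorem mem_posCone (e : I → M) (i : I) : e i ∈ posCone e :=
  AddSubmonoid.subset_closure ⟨1, zero_le_one, i, (one_smul _ _).symm⟩

theorem smul_mem_posCone {e : I → M} {q : ℚ} (hq : 0 ≤ q) {x : M} (hx : x ∈ posCone e) :
    q • x ∈ posCone e := by
  induction hx using AddSubmonoid.closure_induction with
  | mem x hx =>
    obtain ⟨r, hr, i, rfl⟩ := hx
    exact AddSubmonoid.subset_closure ⟨q * r, mul_nonneg hq hr, i, smul_smul _ _ _⟩
  | zero => simp
  | add x y _ _ hx hy => rw [smul_add]; exact add_mem hx hy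

theorem nonneg_of_mem_posCone {e : I → M} {g : M →ₗ[ℚ] ℚ} (hg : ∀ i, 0 ≤ g (e i)) {x : M}
    (hx : x ∈ posCone e) : 0 ≤ g x := by
  induction hx using AddSubmonoid.closure_induction with
  | mem x hx =>
    obtain ⟨r, hr, i, rfl⟩ := hx
    rw [map_smul]
    exact mul_nonneg hr (hg i)
  | zero => simp
  | add x y _ _ hx hy => rw [map_add]; exact add_nonneg hx hy

theorem posCone_le_span (e : I → M) {x : M} (hx : x ∈ posCone e) :
    x ∈ Submodule.span ℚ (Set.range e) := by
  induction hx using AddSubmonoid.closure_induction with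
  | mem x hx =>
    obtain ⟨r, hr, i, rfl⟩ := hx
    exact Submodule.smul_mem _ _ (Submodule.subset_span ⟨i, rfl⟩)
  | zero => exact zero_mem _
  | add x y _ _ hx hy => exact add_mem hx hy

namespace IsRealization

variable {A B : I → I → ℤ} {e : I → M} {f δ : I → (M →ₗ[ℚ] ℚ)}

theorem coord_nonneg (h : IsRealization A B e f δ) (i : I) {x : M} (hx : x ∈ posCone e) :
    0 ≤ δ i x := by
  refine nonneg_of_mem_posCone (fun j => ?_) hx
  by_cases hij : i = j
  · subst hij; rw [h.coord_self]; exact zero_le_one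
  · rw [h.coord_ne i j hij]

theorem eq_zero_of_coord (h : IsRealization A B e f δ) {x : M}
    (hx : x ∈ Submodule.span ℚ (Set.range e)) (h0 : ∀ i, δ i x = 0) : x = 0 := by
  obtain ⟨c, rfl⟩ := (Finsupp.mem_span_range_iff_exists_finsupp).1 hx
  refine Finset.sum_eq_zero fun i hi => ?_
  have hc := h0 i
  rw [Finsupp.sum, map_sum, Finset.sum_eq_single i, map_smul, h.coord_self] at hc
  · simp only [smul_eq_mul, mul_one] at hc
    simp only [hc, zero_smul]
  · intro j _ hj
    rw [map_smul, h.coord_ne i j hj.symm, smul_zero]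
  · intro hi'
    exact absurd hi hi'

theorem eq_zero_of_add_eq_zero (h : IsRealization A B e f δ) {x y : M}
    (hx : x ∈ posCone e) (hy : y ∈ posCone e) (hxy : x + y = 0) : x = 0 := by
  refine h.eq_zero_of_coord (posCone_le_span e hx) fun i => ?_
  have h1 := h.coord_nonneg i hx
  have h2 := h.coord_nonneg i hy
  have h3 : δ i x + δ i y = 0 := by rw [← map_add, hxy, map_zero]
  linarith

theorem ne_zero (h : IsRealization A B e f δ) (i : I) : e i ≠ 0 := fun h0 => by
  have := h.coord_self i
  simp [h0] at this

end IsRealization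

/-- The coefficients of `⋯ r_s r_t e_s` (with `k` reflections) in terms of `e_s` and `e_t`, where
`a = -a_{st}` and `b = -a_{ts}`. -/
def dihedralCoeff (a b : ℚ) : ℕ → ℚ × ℚ
  | 0 => (1, 0)
  | k + 1 =>
    if Even k then ((dihedralCoeff a b k).1, b * (dihedralCoeff a b k).1 - (dihedralCoeff a b k).2)
    else (a * (dihedralCoeff a b k).2 - (dihedralCoeff a b k).1, (dihedralCoeff a b k).2)

theorem dihedralCoeff_nonneg_of_four_le {a b : ℚ} (ha : 0 ≤ a) (hb : 0 ≤ b) (hab : 4 ≤ a * b)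
    (k : ℕ) :
    0 ≤ (dihedralCoeff a b k).1 ∧ 0 ≤ (dihedralCoeff a b k).2 ∧
      if Even k then 2 * (dihedralCoeff a b k).2 ≤ b * (dihedralCoeff a b k).1
      else 2 * (dihedralCoeff a b k).1 ≤ a * (dihedralCoeff a b k).2 := by
  induction k with
  | zero => simp [dihedralCoeff, hb]
  | succ k ih =>
    obtain ⟨hx, hy, hk⟩ := ih
    simp only [dihedralCoeff, Nat.even_add_one]
    generalize (dihedralCoeff a b k).1 = x at *
    generalize (dihedralCoeff a b k).2 = y at *
    by_cases hev : Even k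
    · simp only [hev, if_true, not_true_eq_false, if_false] at *
      refine ⟨hx, by linarith, ?_⟩
      nlinarith [mul_le_mul_of_nonneg_left hk ha, mul_le_mul_of_nonneg_right hab hx]
    · simp only [hev, if_true, not_false_eq_true, if_false] at *
      refine ⟨by linarith, hy, ?_⟩
      nlinarith [mul_le_mul_of_nonneg_left hk hb, mul_le_mul_of_nonneg_right hab hy]

theorem dihedralCoeff_nonneg {a b : ℤ} (ha : a ≤ 0) (hb : b ≤ 0) (hz : a = 0 → b = 0)
    (hz' : b = 0 → a = 0) {k : ℕ} (hk : bondOrder (a * b) = 0 ∨ k < bondOrder (a * b)) :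
    0 ≤ (dihedralCoeff (-a) (-b) k).1 ∧ 0 ≤ (dihedralCoeff (-a) (-b) k).2 := by
  by_cases hab : a * b = 0
  · have ha0 : a = 0 := by rcases mul_eq_zero.1 hab with h | h <;> simp_all
    have hb0 : b = 0 := hz ha0
    subst ha0 hb0
    simp only [bondOrder, mul_zero, if_true] at hk
    have hk' : k < 2 := by omega
    interval_cases k <;> simp [dihedralCoeff]
  by_cases hab' : a * b = 1 ∨ a * b = 2 ∨ a * b = 3
  · rcases eq_of_mul_mem_one_two_three ha hb hab' with h | h | h | h | h <;>
      obtain ⟨rfl, rfl⟩ := h <;>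
      norm_num [bondOrder] at hk <;>
      interval_cases k <;> norm_num [dihedralCoeff, parity_simps]
  · have h4 : (4 : ℤ) ≤ a * b := by
      have := mul_nonneg_of_nonpos_of_nonpos ha hb
      omega
    have h4' : (4 : ℚ) ≤ (-a) * (-b) := by
      rw [neg_mul_neg]; exact_mod_cast h4
    have h := dihedralCoeff_nonneg_of_four_le (by simpa using ha) (by simpa using hb) h4' k
    exact ⟨h.1, h.2.1⟩

namespace IsRealization

variable {A B : I → I → ℤ} {e : I → M} {f δ : I → (M →ₗ[ℚ] ℚ)}

local notation "cs" => CoxeterMatrix.toCoxeterSystem (weylMatrix A)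

theorem weylRep_alternatingWord (h : IsRealization A B e f δ) (s t : {i // A i i = 2}) (k : ℕ) :
    weylRep h ((cs).wordProd (alternatingWord s t k)) (e s) =
      (dihedralCoeff (-(B s t : ℚ)) (-(B t s : ℚ)) k).1 • e s +
      (dihedralCoeff (-(B s t : ℚ)) (-(B t s : ℚ)) k).2 • e t := by
  have hs : f s (e s) = 2 := by rw [h.pair, h.diag, s.2]; rfl
  have ht : f t (e t) = 2 := by rw [h.pair, h.diag, t.2]; rfl
  induction k with
  | zero => simp [alternatingWord, dihedralCoeff]
  | succ k ih =>
    rw [alternatingWord_succ', wordProd_cons, map_mul, Module.End.mul_apply, ih]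
    simp only [dihedralCoeff]
    by_cases hev : Even k
    · simp only [hev, if_true, weylRep_simple_apply, map_add, map_smul, ht, h.pair]
      module
    · simp only [hev, if_false, weylRep_simple_apply, map_add, map_smul, hs, h.pair]
      module

theorem weylRep_mul_alternatingWord_mem (h : IsRealization A B e f δ) {s t : {i // A i i = 2}}
    (hst : s ≠ t) {v : (weylMatrix A).Group} {k : ℕ}
    (hred : (cs).IsReduced (alternatingWord t s (k + 1)))
    (hvs : weylRep h v (e s) ∈ posCone e) (hvt : weylRep h v (e t) ∈ posCone e) :
    weylRep h (v * (cs).wordProd (alternatingWord s t k)) (e s) ∈ posCone e := by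
  have hne : s.1 ≠ t.1 := fun h' => hst (Subtype.ext h')
  rw [map_mul, Module.End.mul_apply, weylRep_alternatingWord, map_add, map_smul, map_smul]
  have hk : bondOrder (B s t * B t s) = 0 ∨ k < bondOrder (B s t * B t s) := by
    rw [h.bond, ← weylMatrix_of_ne A hst]
    by_contra! hcon
    refine (cs).not_isReduced_alternatingWord t s (m := k + 1) ?_ ?_ hred
    · rw [(weylMatrix A).symmetric]; exact hcon.1
    · rw [(weylMatrix A).symmetric]; omega
  obtain ⟨hx, hy⟩ := dihedralCoeff_nonneg (h.off s t hne) (h.off t s hne.symm)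
    (h.zero s t) (h.zero t s) hk
  exact add_mem (smul_mem_posCone hx hvs) (smul_mem_posCone hy hvt)

/-- If `w s` is longer than `w`, then `w e_s` is a nonnegative combination of the `e_i`. -/
theorem weylRep_mem_posCone (h : IsRealization A B e f δ) (s : {i // A i i = 2})
    (w : (weylMatrix A).Group) (hw : ¬ (cs).IsRightDescent w s) :
    weylRep h w (e s) ∈ posCone e := by
  induction hn : (cs).length w using Nat.strong_induction_on generalizing w s with
  | _ n ih =>
  by_cases hw1 : w = 1
  · subst hw1; simpa using mem_posCone e s.1
  obtain ⟨t, ht⟩ := (cs).exists_rightDescent_of_ne_one hw1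
  have hst : s ≠ t := by rintro rfl; exact hw ht
  rw [not_isRightDescent_iff] at hw
  have factor : ∀ (m : ℕ) (v : (weylMatrix A).Group) (k : ℕ), (cs).length v = m → 1 ≤ k →
      w = v * (cs).wordProd (alternatingWord s t k) → (cs).length v + k = n →
      weylRep h w (e s) ∈ posCone e := by
    intro m
    induction m with
    | zero =>
      intro v k hv hk hwv hlen
      have hv1 : v = 1 := (cs).length_eq_zero_iff.1 hv
      rw [hwv]
      refine h.weylRep_mul_alternatingWord_mem hst ?_ ?_ ?_
      · rw [CoxeterSystem.IsReduced, alternatingWord_succ, wordProd_concat]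
        subst hv1
        rw [one_mul] at hwv
        simp only [List.concat_eq_append, List.length_append, length_alternatingWord,
          List.length_singleton]
        rw [← hwv]; omega
      · subst hv1; simpa using mem_posCone e s.1
      · subst hv1; simpa using mem_posCone e t.1
    | succ m ihm =>
      intro v k hv hk hwv hlen
      have hnext : ∀ u : {i // A i i = 2}, (u = s ∨ u = t) →
          (cs).IsRightDescent v u → weylRep h w (e s) ∈ posCone e := by
        intro u hu hdes
        rw [isRightDescent_iff] at hdes
        by_cases hux : u = if Even k then t else s
        · refine ihm (v * (cs).simple u) (k + 1) (by omega) (by omega) ?_ (by omega)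
          rw [alternatingWord_succ', wordProd_cons, ← hux, mul_assoc, simple_mul_simple_cancel_left,
            ← hwv]
        · exfalso
          obtain ⟨k, rfl⟩ : ∃ k', k = k' + 1 := ⟨k - 1, by omega⟩
          have hu' : u = if Even k then t else s := by
            simp only [Nat.even_add_one] at hux
            by_cases hev : Even k
            · simp only [hev, not_true_eq_false, if_false, if_true] at hux ⊢
              exact hu.resolve_left hux
            · simp only [hev, not_false_eq_true, if_false, if_true] at hux ⊢
              exact hu.resolve_right hux
          rw [alternatingWord_succ', wordProd_cons, ← hu', ← mul_assoc] at hwv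
          have h1 := (cs).length_mul_le (v * (cs).simple u)
            ((cs).wordProd (alternatingWord s t k))
          have h2 := (cs).length_wordProd_le (alternatingWord s t k)
          rw [length_alternatingWord] at h2
          rw [← hwv, hn] at h1
          omega
      by_cases hds : (cs).IsRightDescent v s
      · exact hnext s (Or.inl rfl) hds
      by_cases hdt : (cs).IsRightDescent v t
      · exact hnext t (Or.inr rfl) hdt
      rw [hwv]
      refine h.weylRep_mul_alternatingWord_mem hst ?_ (ih _ (by omega) s v hds rfl)
        (ih _ (by omega) t v hdt rfl)
      have h1 := (cs).length_mul_le v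
        ((cs).wordProd (alternatingWord s t k) * (cs).simple s)
      rw [← mul_assoc, ← hwv] at h1
      have h2 := (cs).length_wordProd_le (alternatingWord t s (k + 1))
      rw [CoxeterSystem.IsReduced]
      rw [length_alternatingWord] at h2 ⊢
      rw [alternatingWord_succ, wordProd_concat] at h2 ⊢
      omega
  rw [isRightDescent_iff] at ht
  refine factor _ (w * (cs).simple t) 1 rfl le_rfl ?_ (by omega)
  simp only [alternatingWord, List.concat_eq_append, List.nil_append, wordProd_singleton,
    simple_mul_simple_cancel_right]

variable (A) in
/-- Induction on elements of the Weyl group through reduced expressions. -/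
theorem weyl_induction {p : (weylMatrix A).Group → Prop} (one : p 1)
    (mul : ∀ w s, ¬ (cs).IsRightDescent w s → p w → p (w * (cs).simple s))
    (w : (weylMatrix A).Group) : p w := by
  induction hn : (cs).length w using Nat.strong_induction_on generalizing w with
  | _ n ih =>
  by_cases hw1 : w = 1
  · rwa [hw1]
  obtain ⟨t, ht⟩ := (cs).exists_rightDescent_of_ne_one hw1
  have h1 := (cs).isRightDescent_iff_not_isRightDescent_mul.1 ht
  have h2 := mul _ t h1 (ih _ (hn ▸ ht) _ rfl)
  rwa [simple_mul_simple_cancel_right] at h2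

/-- A dominant vector dominates its Weyl group orbit. -/
theorem sub_weylRep_mem_posCone (h : IsRealization A B e f δ) {x : M}
    (hx : ∀ s : {i // A i i = 2}, 0 ≤ f s x) (w : (weylMatrix A).Group) :
    x - weylRep h w x ∈ posCone e := by
  induction w using weyl_induction A with
  | one => simp
  | mul w s hw ih =>
    have : x - weylRep h (w * (cs).simple s) x =
        (x - weylRep h w x) + f s x • weylRep h w (e s) := by
      rw [map_mul, Module.End.mul_apply, weylRep_simple_apply, map_sub, map_smul]
      abel
    rw [this]
    exact add_mem ih (smul_mem_posCone (hx s) (h.weylRep_mem_posCone s w hw))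

theorem nonpos_of_imaginary (h : IsRealization A B e f δ) {i : I} (hi : A i i ≠ 2)
    (s : {i // A i i = 2}) : B s i ≤ 0 :=
  h.off s i fun hsi => hi (hsi ▸ s.2)

theorem weylRep_imaginary_sub_mem (h : IsRealization A B e f δ) {i : I} (hi : A i i ≠ 2)
    (w : (weylMatrix A).Group) : weylRep h w (e i) - e i ∈ posCone e := by
  have := h.sub_weylRep_mem_posCone (x := -e i) (fun s => by
    rw [map_neg, h.pair]
    simpa using h.nonpos_of_imaginary hi s) w
  simpa [neg_add_eq_sub] using this

theorem weylRep_injective (h : IsRealization A B e f δ) (w : (weylMatrix A).Group) {x : M}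
    (hx : weylRep h w x = 0) : x = 0 := by
  have : weylRep h (w⁻¹ * w) x = 0 := by rw [map_mul, Module.End.mul_apply, hx, map_zero]
  simpa using this

/-- The stabilizer of an imaginary simple root is the same in two realizations whose matrices have
the same zeros. -/
theorem weylRep_fix {M' : Type*} [AddCommGroup M'] [Module ℚ M'] {B' : I → I → ℤ} {e' : I → M'}
    {f' δ' : I → (M' →ₗ[ℚ] ℚ)} (h : IsRealization A B e f δ) (h' : IsRealization A B' e' f' δ')
    (hBB' : ∀ i j, B i j = 0 → B' i j = 0) {i : I} (hi : A i i ≠ 2) (w : (weylMatrix A).Group)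
    (hw : weylRep h w (e i) = e i) : weylRep h' w (e' i) = e' i := by
  induction w using weyl_induction A with
  | one => simp
  | mul w s hws ih =>
    rw [map_mul, Module.End.mul_apply, weylRep_simple_apply, map_sub, map_smul, h.pair] at hw
    have hmem := smul_mem_posCone (q := -(B s i : ℚ))
      (by simpa using h.nonpos_of_imaginary hi s) (h.weylRep_mem_posCone s w hws)
    have hsum : (weylRep h w (e i) - e i) + -(B s i : ℚ) • weylRep h w (e s) = 0 := by
      rw [← sub_eq_zero] at hw
      rw [← hw, neg_smul]
      abel
    have h1 := h.eq_zero_of_add_eq_zero (h.weylRep_imaginary_sub_mem hi w) hmem hsum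
    rw [h1, zero_add, neg_smul, neg_eq_zero] at hsum
    have hB : B s i = 0 := by
      rcases smul_eq_zero.1 hsum with h2 | h2
      · exact_mod_cast h2
      · exact absurd (h.weylRep_injective w h2) (h.ne_zero s)
    rw [map_mul, Module.End.mul_apply, weylRep_simple_apply, h'.pair, hBB' _ _ hB]
    simpa using ih (sub_eq_zero.1 h1)

end IsRealization

end Realization

end GKM

namespace GKM

section Datum

variable {I V : Type*} [AddCommGroup V] [Module ℚ V]

theorem exists_coordinates {α : I → V} (hind : LinearIndependent ℚ α) :
    ∃ δ : I → (V →ₗ[ℚ] ℚ), (∀ i, δ i (α i) = 1) ∧ ∀ i j, i ≠ j → δ i (α j) = 0 := by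
  classical
  have hmem : ∀ j, α j ∈ Submodule.span ℚ (Set.range α) := fun j => Submodule.subset_span ⟨j, rfl⟩
  have hext : ∀ i, ∃ g : V →ₗ[ℚ] ℚ, ∀ j, g (α j) = Finsupp.single j (1 : ℚ) i := by
    intro i
    obtain ⟨g, hg⟩ := LinearMap.exists_extend ((Finsupp.lapply i) ∘ₗ hind.repr)
    refine ⟨g, fun j => ?_⟩
    have := LinearMap.congr_fun hg ⟨α j, hmem j⟩
    simp only [LinearMap.comp_apply, Submodule.subtype_apply] at this
    rw [this]
    simp [hind.repr_eq_single j ⟨α j, hmem j⟩ rfl]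
  choose δ hδ using hext
  refine ⟨δ, fun i => by simp [hδ], fun i j hij => ?_⟩
  rw [hδ, Finsupp.single_eq_of_ne hij]

/-- The functionals on the formal coroot lattice given by pairing with the simple roots. -/
noncomputable def rootPairing (A : I → I → ℤ) (j : I) : (I →₀ ℚ) →ₗ[ℚ] ℚ :=
  Finsupp.linearCombination ℚ fun k => (A k j : ℚ)

theorem isRealization_coroot {A : I → I → ℤ} {α : I → V} {coroot δ : I → (V →ₗ[ℚ] ℚ)}
    (h : IsRealization A A α coroot δ) :
    IsRealization A (fun i j => A j i) (fun j => Finsupp.single j (1 : ℚ)) (rootPairing A)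
      (fun j => Finsupp.lapply j) where
  pair i j := by simp [rootPairing]
  diag _ := rfl
  bond i j := mul_comm _ _
  off i j hij := h.off j i hij.symm
  zero i j := h.zero j i
  coord_self i := by simp
  coord_ne i j hij := by simp [Finsupp.single_eq_of_ne hij]

namespace IsRealization

variable {A : I → I → ℤ} {α : I → V} {coroot δ : I → (V →ₗ[ℚ] ℚ)}

local notation "cs" => CoxeterMatrix.toCoxeterSystem (weylMatrix A)

/-- The coroot of `w α_k`. -/
noncomputable def corootOf (h : IsRealization A A α coroot δ) (w : (weylMatrix A).Group) (k : I) :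
    V →ₗ[ℚ] ℚ :=
  Finsupp.linearCombination ℚ coroot (weylRep (isRealization_coroot h) w (Finsupp.single k 1))

theorem linearCombination_coroot_apply (h : IsRealization A A α coroot δ) (x : I →₀ ℚ) (j : I) :
    Finsupp.linearCombination ℚ coroot x (α j) = rootPairing A j x := by
  simp [rootPairing, Finsupp.linearCombination_apply, Finsupp.sum, h.pair]

theorem linearCombination_weylRep (h : IsRealization A A α coroot δ) (w : (weylMatrix A).Group)
    (x : I →₀ ℚ) (y : V) :
    Finsupp.linearCombination ℚ coroot (weylRep (isRealization_coroot h) w x) y =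
      Finsupp.linearCombination ℚ coroot x (weylRep h w⁻¹ y) := by
  induction w using weyl_induction A generalizing x with
  | one => simp
  | mul w s _ ih =>
    rw [map_mul, Module.End.mul_apply, ih, mul_inv_rev, map_mul, Module.End.mul_apply,
      CoxeterSystem.inv_simple, weylRep_simple_apply, weylRep_simple_apply, map_sub, map_sub,
      map_smul, map_smul, ← h.linearCombination_coroot_apply]
    simp [mul_comm]

theorem corootOf_apply (h : IsRealization A A α coroot δ) (w : (weylMatrix A).Group) (k : I)
    (y : V) : h.corootOf w k y = coroot k (weylRep h w⁻¹ y) := by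
  rw [corootOf, h.linearCombination_weylRep]
  simp

theorem crefl_linearCombination (h : IsRealization A A α coroot δ) (s : {i // A i i = 2})
    (x : I →₀ ℚ) :
    crefl α coroot s (Finsupp.linearCombination ℚ coroot x) = Finsupp.linearCombination ℚ coroot
      (weylRep (isRealization_coroot h) ((cs).simple s) x) := by
  rw [weylRep_simple_apply, map_sub, map_smul, ← h.linearCombination_coroot_apply]
  simp [crefl]

theorem exists_weyl_of_word (h : IsRealization A A α coroot δ) (l : List I)
    (hl : ∀ m ∈ l, A m m = 2) :
    ∃ w : (weylMatrix A).Group, (l.map (srefl α coroot)).prod = weylRep h w ∧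
      ∀ x, (l.map (crefl α coroot)).prod (Finsupp.linearCombination ℚ coroot x) =
        Finsupp.linearCombination ℚ coroot (weylRep (isRealization_coroot h) w x) := by
  induction l with
  | nil => exact ⟨1, by simp⟩
  | cons m l ih =>
    obtain ⟨w, hw1, hw2⟩ := ih fun m' hm' => hl m' (List.mem_cons_of_mem _ hm')
    have hm : A m m = 2 := hl m List.mem_cons_self
    refine ⟨(cs).simple ⟨m, hm⟩ * w, ?_, fun x => ?_⟩
    · rw [List.map_cons, List.prod_cons, hw1, map_mul, weylRep_simple]
    · rw [List.map_cons, List.prod_cons, Module.End.mul_apply, hw2,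
        h.crefl_linearCombination ⟨m, hm⟩, map_mul, Module.End.mul_apply]

theorem exists_weyl_of_pres (h : IsRealization A A α coroot δ) {l : List I} {k : I} {β : V}
    {βv : V →ₗ[ℚ] ℚ} (hp : IsWRootPres A α coroot l k β βv) :
    ∃ w : (weylMatrix A).Group, β = weylRep h w (α k) ∧ βv = h.corootOf w k := by
  obtain ⟨hl, rfl, rfl⟩ := hp
  obtain ⟨w, hw1, hw2⟩ := h.exists_weyl_of_word l hl
  refine ⟨w, by rw [hw1], ?_⟩
  rw [corootOf, ← hw2]
  simp

theorem weylRep_mem_Tmon (h : IsRealization A A α coroot δ) (w : (weylMatrix A).Group) :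
    weylRep h w ∈ Tmon α coroot := by
  induction w using weyl_induction A with
  | one => rw [map_one]; exact one_mem _
  | mul w s _ ih =>
    rw [map_mul, weylRep_simple]
    exact mul_mem ih (Submonoid.subset_closure ⟨_, rfl⟩)

theorem apply_mem_Torbit {lam μ : V} {τ : Module.End ℚ V}
    (hτ : τ ∈ Tmon α coroot) (hμ : μ ∈ Torbit α coroot lam) : τ μ ∈ Torbit α coroot lam := by
  obtain ⟨σ, hσ, rfl⟩ := hμ
  exact ⟨τ * σ, mul_mem hτ hσ, rfl⟩

theorem srefl_mem_Torbit {lam μ : V} (i : I) (hμ : μ ∈ Torbit α coroot lam) :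
    srefl α coroot i μ ∈ Torbit α coroot lam :=
  apply_mem_Torbit (Submonoid.subset_closure ⟨i, rfl⟩) hμ

theorem reflect_mem_Torbit (h : IsRealization A A α coroot δ) {lam μ β : V} {βv : V →ₗ[ℚ] ℚ}
    (hβ : IsWRootPair A α coroot β βv) (hμ : μ ∈ Torbit α coroot lam) :
    μ - βv μ • β ∈ Torbit α coroot lam := by
  obtain ⟨l, k, hp⟩ := hβ
  obtain ⟨w, rfl, rfl⟩ := h.exists_weyl_of_pres hp
  have := apply_mem_Torbit (h.weylRep_mem_Tmon w)
    (srefl_mem_Torbit k (apply_mem_Torbit (h.weylRep_mem_Tmon w⁻¹) hμ))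
  rw [srefl_apply, map_sub, map_smul, ← h.corootOf_apply, ← Module.End.mul_apply, ← map_mul] at this
  simpa using this

theorem nonpos_of_mem_posCone (h : IsRealization A A α coroot δ) {i : I} (hi : A i i ≤ 0) {x : V}
    (hx : x ∈ posCone α) : coroot i x ≤ 0 := by
  have := nonneg_of_mem_posCone (g := -coroot i) (fun j => ?_) hx
  · simpa using this
  · rw [LinearMap.neg_apply, h.pair, neg_nonneg]
    by_cases hij : i = j
    · subst hij; exact_mod_cast hi
    · exact_mod_cast h.off i j hij

theorem mem_posCone_of_mem_Qplus {x : V} (hx : x ∈ Qplus α) : x ∈ posCone α := by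
  obtain ⟨c, rfl⟩ := hx
  exact sum_mem fun i _ => smul_mem_posCone (Nat.cast_nonneg _) (mem_posCone α i)

theorem exists_int_of_mem_Qplus (h : IsRealization A A α coroot δ) (i : I) {x : V}
    (hx : x ∈ Qplus α) : ∃ n : ℤ, coroot i x = n := by
  obtain ⟨c, rfl⟩ := hx
  refine ⟨c.sum fun j n => (n : ℤ) * A i j, ?_⟩
  simp [Finsupp.sum, h.pair]

theorem simple_mem_Qplus (α : I → V) (i : I) : α i ∈ Qplus α :=
  ⟨Finsupp.single i 1, by simp⟩

/-- Elements of `Tλ` lie below `λ`. -/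
theorem sub_mem_posCone_of_mem_Torbit (h : IsRealization A A α coroot δ)
    (hdiag : ∀ i, A i i = 2 ∨ A i i ≤ 0) {lam μ : V} (hlam : lam ∈ Pplus coroot)
    (hμ : μ ∈ Torbit α coroot lam) : lam - μ ∈ posCone α := by
  obtain ⟨τ, hτ, rfl⟩ := hμ
  suffices hW : ∀ w : (weylMatrix A).Group, lam - weylRep h w (τ lam) ∈ posCone α by
    simpa using hW 1
  induction hτ using Submonoid.closure_induction_left with
  | one => exact fun w => h.sub_weylRep_mem_posCone (fun s => hlam.2 s) w
  | mul_left σ hσ τ _ ih =>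
    intro w
    obtain ⟨j, rfl⟩ := hσ
    rcases hdiag j with hj | hj
    · have := ih (w * (cs).simple ⟨j, hj⟩)
      rwa [map_mul, weylRep_simple, Module.End.mul_apply] at this
    · have hj2 : A j j ≠ 2 := by omega
      have hc : 0 ≤ coroot j (τ lam) := by
        have h1 := h.nonpos_of_mem_posCone hj (ih 1)
        have h2 := hlam.2 j
        rw [map_one, Module.End.one_apply, map_sub] at h1
        linarith
      have hmem : weylRep h w (α j) ∈ posCone α := by
        simpa using add_mem (h.weylRep_imaginary_sub_mem hj2 w) (mem_posCone α j)
      have hsplit : lam - weylRep h w ((srefl α coroot j * τ) lam) =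
          (lam - weylRep h w (τ lam)) + coroot j (τ lam) • weylRep h w (α j) := by
        rw [Module.End.mul_apply, srefl_apply, map_sub, map_smul]
        abel
      rw [hsplit]
      exact add_mem (ih w) (smul_mem_posCone hc hmem)

theorem nonneg_of_mem_Torbit (h : IsRealization A A α coroot δ)
    (hdiag : ∀ i, A i i = 2 ∨ A i i ≤ 0) {lam μ : V} (hlam : lam ∈ Pplus coroot)
    (hμ : μ ∈ Torbit α coroot lam) {i : I} (hi : A i i ≤ 0) : 0 ≤ coroot i μ := by
  have h1 := h.nonpos_of_mem_posCone hi (h.sub_mem_posCone_of_mem_Torbit hdiag hlam hμ)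
  have h2 := hlam.2 i
  rw [map_sub] at h1
  linarith

theorem corootOf_real_eq_zero (h : IsRealization A A α coroot δ) {i : I} (hi : A i i ≤ 0)
    (s : {i // A i i = 2}) (w : (weylMatrix A).Group)
    (h0 : coroot i (weylRep h w (α s)) = 0) : h.corootOf w s (α i) = 0 := by
  have hK := isRealization_coroot h
  have hfix : weylRep hK (w * (cs).simple s * w⁻¹) (Finsupp.single i 1) = Finsupp.single i 1 := by
    simp only [map_mul, Module.End.mul_apply, weylRep_simple_apply]
    rw [← h.linearCombination_coroot_apply, h.linearCombination_weylRep, inv_inv]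
    simp only [Finsupp.linearCombination_single, one_smul, h0, zero_smul, sub_zero]
    rw [← Module.End.mul_apply, ← map_mul]
    simp
  have hfix' := weylRep_fix hK h (fun i j => h.zero j i) (i := i) (by omega) _ hfix
  simp only [map_mul, Module.End.mul_apply, weylRep_simple_apply, map_sub, map_smul] at hfix'
  rw [← h.corootOf_apply, ← Module.End.mul_apply, ← map_mul, mul_inv_cancel, map_one,
    Module.End.one_apply, sub_eq_self] at hfix'
  rcases smul_eq_zero.1 hfix' with h1 | h1
  · exact h1
  · exact absurd (h.weylRep_injective w h1) (h.ne_zero s)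

theorem corootOf_eq_zero (h : IsRealization A A α coroot δ) (hdiag : ∀ i, A i i = 2 ∨ A i i ≤ 0)
    {i : I} (hi : A i i ≤ 0) (m : I) (w : (weylMatrix A).Group)
    (h0 : coroot i (weylRep h w (α m)) = 0) : h.corootOf w m (α i) = 0 := by
  rcases hdiag m with hm | hm
  · exact h.corootOf_real_eq_zero hi ⟨m, hm⟩ w h0
  have hm2 : A m m ≠ 2 := by omega
  induction w using weyl_induction A with
  | one =>
    rw [map_one, Module.End.one_apply, h.pair, Int.cast_eq_zero] at h0
    simp [corootOf_apply, h.pair, h.zero _ _ h0]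
  | mul w s hws ih =>
    have hmem : weylRep h w (α m) ∈ posCone α := by
      simpa using add_mem (h.weylRep_imaginary_sub_mem hm2 w) (mem_posCone α m)
    have h1 := h.nonpos_of_mem_posCone hi hmem
    have h2 := h.nonpos_of_mem_posCone hi (h.weylRep_mem_posCone s w hws)
    have h3 : (A s m : ℚ) ≤ 0 := by exact_mod_cast h.nonpos_of_imaginary hm2 s
    rw [map_mul, Module.End.mul_apply, weylRep_simple_apply, map_sub, map_smul, map_sub, map_smul,
      h.pair, smul_eq_mul] at h0
    have h4 := mul_nonneg_of_nonpos_of_nonpos h3 h2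
    have h5 : (A s m : ℚ) * coroot i (weylRep h w (α s)) = 0 := by linarith
    have hih := ih (by linarith)
    have hsplit : h.corootOf (w * (cs).simple s) m = h.corootOf w m -
        (A m s : ℚ) • h.corootOf w s := by
      simp only [corootOf]
      rw [map_mul, Module.End.mul_apply, weylRep_simple_apply, map_sub, map_smul,
        (isRealization_coroot h).pair, map_sub, map_smul]
    rw [hsplit, LinearMap.sub_apply, LinearMap.smul_apply, hih]
    rcases mul_eq_zero.1 h5 with h6 | h6
    · rw [h.zero _ _ (Int.cast_eq_zero.1 h6)]
      simp
    · rw [h.corootOf_real_eq_zero hi s w h6]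
      simp

theorem coord_weylRep_imaginary (h : IsRealization A A α coroot δ) {i : I} (hi : A i i ≠ 2)
    (w : (weylMatrix A).Group) (x : V) : δ i (weylRep h w x) = δ i x := by
  induction w using weyl_induction A generalizing x with
  | one => simp
  | mul w s _ ih =>
    rw [map_mul, Module.End.mul_apply, ih, weylRep_simple_apply, map_sub, map_smul,
      h.coord_ne i s fun his => hi (his ▸ s.2)]
    simp

/-- The only multiple of an imaginary simple root `α_i` in `WΠ` is `α_i`, and its coroot is
`α_i^∨`. -/
theorem eq_simple_of_eq_smul (h : IsRealization A A α coroot δ)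
    {i : I} (hi : A i i ≠ 2) {β : V} {βv : V →ₗ[ℚ] ℚ}
    (hβ : IsWRootPair A α coroot β βv) {c : ℚ} (hc : β = c • α i) :
    β = α i ∧ βv = coroot i := by
  obtain ⟨l, m, hp⟩ := hβ
  obtain ⟨w, rfl, rfl⟩ := h.exists_weyl_of_pres hp
  by_cases hm : A m m = 2
  · exfalso
    have h1 := h.coord_weylRep_imaginary hi w (α m)
    rw [hc, map_smul, h.coord_self, h.coord_ne i m (by rintro rfl; exact hi hm), smul_eq_mul,
      mul_one] at h1
    rw [h1, zero_smul] at hc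
    exact h.ne_zero m (h.weylRep_injective w hc)
  · have h1 := h.coord_weylRep_imaginary hm w (α m)
    rw [hc, map_smul, h.coord_self] at h1
    by_cases him : m = i
    · subst him
      rw [h.coord_self, smul_eq_mul, mul_one] at h1
      rw [h1, one_smul] at hc
      refine ⟨hc, ?_⟩
      rw [corootOf, weylRep_fix h (isRealization_coroot h) (fun i j => h.zero i j) hi w hc]
      simp
    · rw [h.coord_ne m i him] at h1
      simp at h1

theorem rootPair_apply_eq_zero (h : IsRealization A A α coroot δ)
    (hdiag : ∀ i, A i i = 2 ∨ A i i ≤ 0) {i : I} (hi : A i i ≤ 0) {β : V} {βv : V →ₗ[ℚ] ℚ}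
    (hβ : IsWRootPair A α coroot β βv) (h0 : coroot i β = 0) : βv (α i) = 0 := by
  obtain ⟨l, m, hp⟩ := hβ
  obtain ⟨w, rfl, rfl⟩ := h.exists_weyl_of_pres hp
  exact h.corootOf_eq_zero hdiag hi m w h0

end IsRealization

section Chains

variable {A : I → I → ℤ} {α : I → V} {coroot δ : I → (V →ₗ[ℚ] ℚ)} {lam μ ν : V} {s : ℕ}
  {c : ℕ → V} {β : ℕ → V} {βv : ℕ → (V →ₗ[ℚ] ℚ)}

theorem IsChain.antitone (hc : IsChain A α coroot lam μ ν s c β βv) {g : V →ₗ[ℚ] ℚ}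
    (hg : ∀ x ∈ Qplus α, g x ≤ 0) {k l : ℕ} (hkl : k ≤ l) (hls : l ≤ s) : g (c l) ≤ g (c k) := by
  induction l, hkl using Nat.le_induction with
  | base => exact le_rfl
  | succ l _ ih =>
    obtain ⟨_, hβ, hpos, heq⟩ := hc.2.2.2 l (by omega)
    refine le_trans ?_ (ih (by omega))
    rw [heq, map_sub, map_smul, smul_eq_mul]
    nlinarith [hg _ hβ]

theorem IsChain.eq_zero (hc : IsChain A α coroot lam μ ν s c β βv) {g : V →ₗ[ℚ] ℚ}
    (hg : ∀ x ∈ Qplus α, g x ≤ 0) (hμν : g μ = g ν) {k : ℕ} (hk : k < s) : g (β k) = 0 := by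
  have h1 := hc.antitone hg (Nat.zero_le k) hk.le
  have h2 := hc.antitone hg (Nat.succ_le_of_lt hk) le_rfl
  rw [hc.1, hμν] at h1
  rw [hc.2.1] at h2
  obtain ⟨_, hβ, hpos, heq⟩ := hc.2.2.2 k hk
  have h3 := hg _ hβ
  rw [heq, map_sub, map_smul, smul_eq_mul] at h1
  nlinarith

/-- An imaginary simple reflection maps a chain along orthogonal roots to a chain. -/
theorem IsChain.map_srefl (h : IsRealization A A α coroot δ)
    (hdiag : ∀ i, A i i = 2 ∨ A i i ≤ 0) {i : I} (hi : A i i ≤ 0)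
    (hc : IsChain A α coroot lam μ ν s c β βv) (h0 : ∀ k < s, coroot i (β k) = 0) :
    IsChain A α coroot lam (srefl α coroot i μ) (srefl α coroot i ν) s
      (fun k => srefl α coroot i (c k)) β βv := by
  obtain ⟨rfl, rfl, horb, hstep⟩ := hc
  refine ⟨rfl, rfl, fun k hk => IsRealization.srefl_mem_Torbit i (horb k hk), fun k hk => ?_⟩
  obtain ⟨hroot, hQ, hpos, heq⟩ := hstep k hk
  have hv := h.rootPair_apply_eq_zero hdiag hi hroot (h0 k hk)
  have hval : βv k (srefl α coroot i (c (k + 1))) = βv k (c (k + 1)) := by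
    simp [srefl_apply, hv]
  refine ⟨hroot, hQ, by rwa [hval], ?_⟩
  dsimp only
  rw [hval]
  conv_lhs => rw [heq]
  rw [map_sub, map_smul, srefl_apply _ _ _ (β k), h0 k hk, zero_smul, sub_zero]

theorem coroot_nonpos_of_mem_Qplus (h : IsRealization A A α coroot δ) {i : I} (hi : A i i ≤ 0)
    (x : V) (hx : x ∈ Qplus α) : coroot i x ≤ 0 :=
  h.nonpos_of_mem_posCone hi (IsRealization.mem_posCone_of_mem_Qplus hx)

theorem distEq_map_srefl (h : IsRealization A A α coroot δ)
    (hdiag : ∀ i, A i i = 2 ∨ A i i ≤ 0) {i : I} (hi : A i i ≤ 0)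
    (hd : distEq A α coroot lam μ ν 1) (hμν : coroot i μ = coroot i ν) :
    distEq A α coroot lam (srefl α coroot i μ) (srefl α coroot i ν) 1 := by
  obtain ⟨⟨c, β, βv, hc⟩, hmax⟩ := hd
  have hQ := coroot_nonpos_of_mem_Qplus h hi
  refine ⟨⟨_, β, βv, hc.map_srefl h hdiag hi fun k hk => hc.eq_zero hQ hμν hk⟩, ?_⟩
  intro m d γ γv hd
  have h0 : ∀ k < m, coroot i (γ k) = 0 := fun k hk => hd.eq_zero hQ (by
    simp only [srefl_apply, map_sub, map_smul, hμν]) hk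
  have hv : ∀ k < m, γv k (α i) = 0 := fun k hk =>
    h.rootPair_apply_eq_zero hdiag hi (hd.2.2.2 k hk).1 (h0 k hk)
  have hstep : ∀ k < m, d k + coroot i ν • α i = (d (k + 1) + coroot i ν • α i) -
      γv k (d (k + 1) + coroot i ν • α i) • γ k := by
    intro k hk
    rw [(hd.2.2.2 k hk).2.2.2, map_add, map_smul, hv k hk, smul_zero, add_zero]
    abel
  refine hmax m (fun k => d k + coroot i ν • α i) γ γv ⟨?_, ?_, ?_, ?_⟩
  · simp only [hd.1, srefl_apply, hμν, sub_add_cancel]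
  · simp only [hd.2.1, srefl_apply, sub_add_cancel]
  · intro k hk
    refine Nat.decreasingInduction'
      (P := fun k => d k + coroot i ν • α i ∈ Torbit α coroot lam) ?_ hk ?_
    · intro k hkm _ ih
      simp only [hstep k hkm]
      exact h.reflect_mem_Torbit (hd.2.2.2 k hkm).1 ih
    · simp only [hd.2.1, srefl_apply, sub_add_cancel]
      rw [← hc.2.1]
      exact hc.2.2.1 1 le_rfl
  · intro k hk
    refine ⟨(hd.2.2.2 k hk).1, (hd.2.2.2 k hk).2.1, ?_, hstep k hk⟩
    simpa [hv k hk] using (hd.2.2.2 k hk).2.2.1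

theorem isWRootPres_simple (A : I → I → ℤ) (α : I → V) (coroot : I → (V →ₗ[ℚ] ℚ)) (i : I) :
    IsWRootPres A α coroot [] i (α i) (coroot i) := by
  simp [IsWRootPres]

theorem distEq_srefl_self (h : IsRealization A A α coroot δ) {i : I} (hi : A i i ≤ 0)
    (hμ : μ ∈ Torbit α coroot lam) (hpos : 0 < coroot i μ) :
    distEq A α coroot lam (srefl α coroot i μ) μ 1 := by
  have hi2 : A i i ≠ 2 := by omega
  refine ⟨⟨fun k => if k = 0 then srefl α coroot i μ else μ, fun _ => α i, fun _ => coroot i,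
    rfl, rfl, ?_, ?_⟩, ?_⟩
  · intro k _
    dsimp only
    split_ifs
    · exact IsRealization.srefl_mem_Torbit i hμ
    · exact hμ
  · intro k hk
    obtain rfl : k = 0 := by omega
    exact ⟨⟨_, _, isWRootPres_simple A α coroot i⟩, IsRealization.simple_mem_Qplus α i,
      by simpa using hpos, by simp [srefl_apply]⟩
  · intro m d γ γv hd
    by_contra! hm
    have hneg : ∀ j, ∀ x ∈ Qplus α, (-δ j) x ≤ 0 := fun j x hx => by
      have := h.coord_nonneg j (IsRealization.mem_posCone_of_mem_Qplus hx)
      simpa using this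
    have hroot : ∀ k < m, γ k = α i ∧ γv k = coroot i := by
      intro k hk
      refine h.eq_simple_of_eq_smul hi2 (hd.2.2.2 k hk).1 (c := δ i (γ k)) ?_
      rw [← sub_eq_zero]
      refine h.eq_zero_of_coord ?_ fun j => ?_
      · exact sub_mem (posCone_le_span α
          (IsRealization.mem_posCone_of_mem_Qplus (hd.2.2.2 k hk).2.1))
          (Submodule.smul_mem _ _ (Submodule.subset_span ⟨i, rfl⟩))
      · rw [map_sub, map_smul, smul_eq_mul]
        by_cases hji : j = i
        · subst hji
          rw [h.coord_self, mul_one, sub_self]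
        · have := hd.eq_zero (hneg j) (by simp [srefl_apply, h.coord_ne j i hji]) hk
          rw [h.coord_ne j i hji, mul_zero, sub_zero]
          simpa using this
    obtain ⟨m, rfl⟩ : ∃ m', m = m' + 2 := ⟨m - 2, by omega⟩
    have hlast := (hd.2.2.2 (m + 1) (by omega)).2.2.2
    rw [(hroot (m + 1) (by omega)).1, (hroot (m + 1) (by omega)).2, hd.2.1, ← srefl_apply,
      ← hd.1] at hlast
    obtain ⟨_, _, hpos0, heq0⟩ := hd.2.2.2 0 (by omega)
    have hanti := hd.antitone (hneg i) (k := 1) (l := m + 1) (by omega) (by omega)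
    rw [hlast, heq0, (hroot 0 (by omega)).1] at hanti
    simp only [LinearMap.neg_apply, map_sub, map_smul, h.coord_self, zero_add, smul_eq_mul] at hanti
    simp only [zero_add] at hpos0
    linarith

theorem IsAChain.coroot_eq_zero (h : IsRealization A A α coroot δ)
    (hdiag : ∀ i, A i i = 2 ∨ A i i ≤ 0) (hlam : lam ∈ Pplus coroot) {i : I} (hi : A i i ≤ 0)
    {a : ℚ} (ha : 0 < a) {ks : ℕ → I} (hc : IsAChain A α coroot lam a μ ν s c β βv ks)
    (hlt : a * coroot i μ < 1) {k : ℕ} (hk : k < s) : coroot i (β k) = 0 := by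
  obtain ⟨_, hc, hcond⟩ := hc
  obtain ⟨_, _, hre, him⟩ := hcond k hk
  obtain ⟨_, hQ, hpos, heq⟩ := hc.2.2.2 k hk
  have hQ' := coroot_nonpos_of_mem_Qplus h hi
  obtain ⟨n, hn⟩ := h.exists_int_of_mem_Qplus i hQ
  have hn0 := hQ' _ hQ
  by_contra hne
  have hle : coroot i (β k) ≤ -1 := by
    rw [hn] at hn0 hne ⊢
    have h1 : n ≤ 0 := by exact_mod_cast hn0
    have h2 : n ≠ 0 := by exact_mod_cast hne
    have h3 : n ≤ -1 := by omega
    exact_mod_cast h3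
  have hax : 1 ≤ a * βv k (c (k + 1)) := by
    by_cases hks : A (ks k) (ks k) = 2
    · obtain ⟨n, hn1, hn2⟩ := hre hks
      rw [hn2]
      exact_mod_cast hn1
    · exact (him hks).ge
  have h1 := hc.antitone hQ' (Nat.zero_le k) hk.le
  have h2 := h.nonneg_of_mem_Torbit hdiag hlam (hc.2.2.1 (k + 1) hk) hi
  rw [hc.1, heq, map_sub, map_smul, smul_eq_mul] at h1
  have h3 : βv k (c (k + 1)) ≤ coroot i μ := by nlinarith
  nlinarith

theorem HasAChain.coroot_eq (h : IsRealization A A α coroot δ)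
    (hdiag : ∀ i, A i i = 2 ∨ A i i ≤ 0) (hlam : lam ∈ Pplus coroot) {i : I} (hi : A i i ≤ 0)
    {a : ℚ} (ha : 0 < a) (hc : HasAChain A α coroot lam a μ ν)
    (hlt : a * coroot i μ < 1) : coroot i μ = coroot i ν := by
  obtain ⟨s, c, β, βv, ks, hc⟩ := hc
  have hconst : ∀ k ≤ s, coroot i (c 0) = coroot i (c k) := by
    intro k
    induction k with
    | zero => exact fun _ => rfl
    | succ k ih =>
      intro hk
      rw [ih (by omega), (hc.2.1.2.2.2 k hk).2.2.2, map_sub, map_smul,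
        hc.coroot_eq_zero h hdiag hlam hi ha hlt hk, smul_zero, sub_zero]
  have := hconst s le_rfl
  rwa [hc.2.1.1, hc.2.1.2.1] at this

theorem HasAChain.coroot_le (h : IsRealization A A α coroot δ) {i : I} (hi : A i i ≤ 0)
    {a : ℚ} (hc : HasAChain A α coroot lam a μ ν) : coroot i ν ≤ coroot i μ := by
  obtain ⟨s, c, β, βv, ks, _, hc, _⟩ := hc
  have := hc.antitone (coroot_nonpos_of_mem_Qplus h hi) (Nat.zero_le s) le_rfl
  rwa [hc.1, hc.2.1] at this

theorem HasAChain.map_srefl (h : IsRealization A A α coroot δ)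
    (hdiag : ∀ i, A i i = 2 ∨ A i i ≤ 0) (hlam : lam ∈ Pplus coroot) {i : I} (hi : A i i ≤ 0)
    {a : ℚ} (ha : 0 < a) (hc : HasAChain A α coroot lam a μ ν)
    (hlt : a * coroot i μ < 1) :
    HasAChain A α coroot lam a (srefl α coroot i μ) (srefl α coroot i ν) := by
  obtain ⟨s, c, β, βv, ks, hc⟩ := hc
  have h0 : ∀ k < s, coroot i (β k) = 0 :=
    fun k hk => hc.coroot_eq_zero h hdiag hlam hi ha hlt hk
  refine ⟨s, _, β, βv, ks, hc.1, hc.2.1.map_srefl h hdiag hi h0, fun k hk => ?_⟩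
  obtain ⟨hpres, hdist, hre, him⟩ := hc.2.2 k hk
  obtain ⟨hroot, _, _, heq⟩ := hc.2.1.2.2.2 k hk
  have hval : βv k (srefl α coroot i (c (k + 1))) = βv k (c (k + 1)) := by
    simp [srefl_apply, h.rootPair_apply_eq_zero hdiag hi hroot (h0 k hk)]
  refine ⟨hpres, distEq_map_srefl h hdiag hi hdist ?_, by rwa [hval], by rwa [hval]⟩
  rw [heq, map_sub, map_smul, h0 k hk, smul_zero, sub_zero]

/-- Prepending the step from `μ` to `r_i μ`, `i` imaginary, to a possibly empty `a`-chain. -/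
theorem HasAChain.cons_srefl (h : IsRealization A A α coroot δ) {i : I} (hi : A i i ≤ 0)
    {a : ℚ} (hμ : μ ∈ Torbit α coroot lam) (hμ0 : 0 < coroot i μ) (haμ : a * coroot i μ = 1)
    (hc : μ = ν ∨ HasAChain A α coroot lam a μ ν) :
    HasAChain A α coroot lam a (srefl α coroot i μ) ν := by
  have hstep : ∀ (s : ℕ) (c β : ℕ → V) (βv : ℕ → (V →ₗ[ℚ] ℚ)) (ks : ℕ → I),
      IsChain A α coroot lam μ ν s c β βv →
      (∀ k < s, (∃ l, IsWRootPres A α coroot l (ks k) (β k) (βv k)) ∧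
        distEq A α coroot lam (c k) (c (k+1)) 1 ∧
        (A (ks k) (ks k) = 2 → ∃ n : ℕ, 0 < n ∧ a * βv k (c (k+1)) = (n : ℚ)) ∧
        (A (ks k) (ks k) ≠ 2 → a * βv k (c (k+1)) = 1)) →
      HasAChain A α coroot lam a (srefl α coroot i μ) ν := by
    intro s c β βv ks hc hcond
    have hc0 : c 0 = μ := hc.1
    refine ⟨s + 1, fun k => k.casesOn (srefl α coroot i μ) c, fun k => k.casesOn (α i) β,
      fun k => k.casesOn (coroot i) βv, fun k => k.casesOn i ks, by omega,
      ⟨rfl, hc.2.1, ?_, ?_⟩, ?_⟩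
    · rintro (_ | k) hk
      · exact IsRealization.srefl_mem_Torbit i hμ
      · exact hc.2.2.1 k (by omega)
    · rintro (_ | k) hk
      · refine ⟨⟨_, _, isWRootPres_simple A α coroot i⟩, IsRealization.simple_mem_Qplus α i, ?_, ?_⟩
        · simpa [hc0] using hμ0
        · simp [hc0, srefl_apply]
      · exact hc.2.2.2 k (by omega)
    · rintro (_ | k) hk
      · refine ⟨⟨_, isWRootPres_simple A α coroot i⟩, ?_, ?_, ?_⟩
        · simpa [hc0] using distEq_srefl_self h hi hμ hμ0
        · intro h2
          have hi2 : A i i = 2 := h2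
          omega
        · intro _
          simpa [hc0] using haμ
      · exact hcond k (by omega)
  rcases hc with rfl | ⟨s, c, β, βv, ks, _, hc, hcond⟩
  · exact hstep 0 (fun _ => μ) (fun _ => 0) (fun _ => 0) (fun _ => i)
      ⟨rfl, rfl, fun _ _ => hμ, fun k hk => absurd hk (by omega)⟩ fun k hk => absurd hk (by omega)
  · exact hstep s c β βv ks hc hcond

end Chains

end Datum

end GKM

namespace GKM

section Paths

variable {V : Type*} [AddCommGroup V] [Module ℚ V] {x y : ℕ → V} {a : ℕ → ℚ} {s : ℕ} {t : ℚ}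

theorem glsPath_eq_sum (ha : ∀ k < s, a k ≤ a (k + 1)) :
    glsPath x a s t = ∑ k ∈ Finset.range s, (min t (a (k + 1)) - min t (a k)) • x (k + 1) := by
  refine Finset.sum_congr rfl fun k hk => ?_
  have hk := ha k (Finset.mem_range.1 hk)
  congr 1
  rcases le_total t (a k) with h | h
  · rw [min_eq_left h, min_eq_left (h.trans hk), sub_self, max_eq_right (sub_nonpos.2 h)]
  · rw [min_eq_right h, max_eq_left (sub_nonneg.2 (le_min h hk))]

theorem sum_min_sub_min (ha : a 0 = 0) (ht : 0 ≤ t) (s : ℕ) :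
    ∑ k ∈ Finset.range s, (min t (a (k + 1)) - min t (a k)) = min t (a s) := by
  rw [Finset.sum_range_sub fun k => min t (a k), ha, min_eq_right ht, sub_zero]

theorem map_glsPath (g : V →ₗ[ℚ] ℚ) :
    g (glsPath x a s t) = glsPath (fun k => g (x k)) a s t := by
  simp [glsPath, map_sum]

theorem glsPath_zero (ha : ∀ k < s, 0 ≤ a k) : glsPath x a s 0 = 0 := by
  refine Finset.sum_eq_zero fun k hk => ?_
  have h0 := ha k (Finset.mem_range.1 hk)
  rw [max_eq_right, zero_smul]
  linarith [min_le_left 0 (a (k + 1))]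

theorem glsPath_mono {u : ℕ → ℚ} (hu : ∀ k < s, 0 ≤ u (k + 1)) : Monotone (glsPath u a s) := by
  intro t t' htt'
  refine Finset.sum_le_sum fun k hk => ?_
  refine mul_le_mul_of_nonneg_right ?_ (hu k (Finset.mem_range.1 hk))
  gcongr

theorem le_of_succ_le (ha : ∀ k < s, a k ≤ a (k + 1)) {k l : ℕ} (hkl : k ≤ l) (hl : l ≤ s) :
    a k ≤ a l := by
  induction l, hkl using Nat.le_induction with
  | base => exact le_rfl
  | succ l _ ih => exact (ih (by omega)).trans (ha l (by omega))

/-- A path with non-increasing slopes lies above the line through the origin whose slope is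
the current one. -/
theorem mul_le_glsPath {u : ℕ → ℚ} (ha : ∀ k < s, a k ≤ a (k + 1)) (ha0 : a 0 = 0) {j : ℕ}
    (hj : j ≤ s) (hu : ∀ k < j, u j ≤ u (k + 1)) : a j * u j ≤ glsPath u a s (a j) := by
  have h0 : 0 ≤ a j := ha0 ▸ le_of_succ_le ha (Nat.zero_le j) hj
  have h1 := sum_min_sub_min ha0 h0 s
  rw [min_eq_left (le_of_succ_le ha hj le_rfl)] at h1
  rw [glsPath_eq_sum ha]
  nth_rewrite 1 [← h1]
  rw [Finset.sum_mul]
  refine Finset.sum_le_sum fun k hk => ?_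
  have hks := Finset.mem_range.1 hk
  rcases lt_or_ge k j with hkj | hkj
  · exact mul_le_mul_of_nonneg_left (hu k hkj)
      (sub_nonneg.2 (min_le_min_left _ (ha k hks)))
  · rw [min_eq_left (le_of_succ_le ha hkj hks.le),
      min_eq_left (le_of_succ_le ha (hkj.trans (Nat.le_succ k)) hks)]
    simp

theorem glsPath_eq_mul {u : ℕ → ℚ} (ha : ∀ k < s, a k ≤ a (k + 1)) (ha0 : a 0 = 0) {p : ℕ}
    (hp : p ≤ s) {c : ℚ} (hu : ∀ k < p, u (k + 1) = c) (ht : 0 ≤ t) (htp : t ≤ a p) :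
    glsPath u a s t = t * c := by
  have h1 := sum_min_sub_min ha0 ht s
  rw [min_eq_left (htp.trans (le_of_succ_le ha hp le_rfl))] at h1
  rw [glsPath_eq_sum ha]
  nth_rewrite 3 [← h1]
  rw [Finset.sum_mul]
  refine Finset.sum_congr rfl fun k hk => ?_
  have hks := Finset.mem_range.1 hk
  rcases lt_or_ge k p with hkp | hkp
  · rw [hu k hkp, smul_eq_mul]
  · rw [min_eq_left (htp.trans (le_of_succ_le ha hkp hks.le)),
      min_eq_left (htp.trans (le_of_succ_le ha (hkp.trans (Nat.le_succ k)) hks))]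
    simp

theorem glsPath_shift (ha : ∀ k < s, a k ≤ a (k + 1)) (ha0 : a 0 = 0) {p : ℕ} (hp : p ≤ s) {v : V}
    (hy : ∀ k < s, y (k + 1) = if k < p then x (k + 1) - v else x (k + 1)) (ht : 0 ≤ t) :
    glsPath y a s t = glsPath x a s t - min t (a p) • v := by
  have h0 : 0 ≤ a p := ha0 ▸ le_of_succ_le ha (Nat.zero_le p) hp
  have h1 := sum_min_sub_min ha0 (le_min ht h0) s
  rw [min_eq_left ((min_le_right t _).trans (le_of_succ_le ha hp le_rfl))] at h1
  rw [glsPath_eq_sum ha, glsPath_eq_sum ha, ← h1, Finset.sum_smul, ← Finset.sum_sub_distrib]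
  refine Finset.sum_congr rfl fun k hk => ?_
  have hks := Finset.mem_range.1 hk
  rw [hy k hks]
  split_ifs with hkp
  · rw [min_assoc, min_assoc, min_eq_right (le_of_succ_le ha hkp hp),
      min_eq_right (le_of_succ_le ha hkp.le hp), smul_sub]
  · push Not at hkp
    rw [min_eq_left ((min_le_right t _).trans (le_of_succ_le ha hkp hks.le)),
      min_eq_left ((min_le_right t _).trans (le_of_succ_le ha (hkp.trans (Nat.le_succ k)) hks)),
      sub_self, zero_smul, sub_zero]

/-- Insert the breakpoint `b` at position `p`. -/
def insertBreak (a : ℕ → ℚ) (p : ℕ) (b : ℚ) (k : ℕ) : ℚ :=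
  if k ≤ p - 1 then a k else if k = p then b else a (k - 1)

theorem insertBreak_of_lt (b : ℚ) {p k : ℕ} (hk : k < p) : insertBreak a p b k = a k :=
  if_pos (by omega)

theorem insertBreak_self (b : ℚ) {p : ℕ} (hp : 1 ≤ p) : insertBreak a p b p = b := by
  rw [insertBreak, if_neg (by omega), if_pos rfl]

theorem insertBreak_succ (b : ℚ) {p k : ℕ} (hp : 1 ≤ p) (hk : p ≤ k) :
    insertBreak a p b (k + 1) = a k := by
  rw [insertBreak, if_neg (by omega), if_neg (by omega), Nat.add_sub_cancel]

theorem insertBreak_le_succ {r : ℚ → ℚ → Prop} {p : ℕ} {b : ℚ} (hp1 : 1 ≤ p) (hp : p ≤ s)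
    (hb : r (a (p - 1)) b) (hb' : r b (a p)) (ha : ∀ k < s, r (a k) (a (k + 1))) :
    ∀ k < s + 1, r (insertBreak a p b k) (insertBreak a p b (k + 1)) := by
  intro k hk
  rcases lt_trichotomy (k + 1) p with hkp | rfl | hkp
  · rw [insertBreak_of_lt b hkp, insertBreak_of_lt b (by omega)]
    exact ha k (by omega)
  · rw [insertBreak_self b hp1, insertBreak_of_lt b (by omega)]
    simpa using hb
  · rw [insertBreak_succ b hp1 (by omega)]
    rcases eq_or_lt_of_le (show p ≤ k by omega) with rfl | hlt
    · rw [insertBreak_self b hp1]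
      exact hb'
    · obtain ⟨k, rfl⟩ : ∃ k', k = k' + 1 := ⟨k - 1, by omega⟩
      rw [insertBreak_succ b hp1 (by omega)]
      exact ha k (by omega)

theorem glsPath_insertBreak {p : ℕ} {b : ℚ} (hp1 : 1 ≤ p) (hp : p ≤ s) (hb : a (p - 1) ≤ b)
    (hb' : b ≤ a p) (ha : ∀ k < s, a k ≤ a (k + 1)) :
    glsPath (fun k => if k ≤ p then x k else x (k - 1)) (insertBreak a p b) (s + 1) t =
      glsPath x a s t := by
  rw [glsPath_eq_sum (insertBreak_le_succ hp1 hp hb hb' ha), glsPath_eq_sum ha]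
  obtain ⟨q, rfl⟩ : ∃ q, p = q + 1 := ⟨p - 1, by omega⟩
  obtain ⟨r, rfl⟩ := Nat.exists_eq_add_of_le hp
  rw [show q + 1 + r + 1 = q + 1 + 1 + r by omega, Finset.sum_range_add _ (q + 1 + 1) r,
    Finset.sum_range_add _ (q + 1) r, Finset.sum_range_succ _ (q + 1), Finset.sum_range_succ _ q,
    Finset.sum_range_succ _ q]
  have h1 : ∀ k ∈ Finset.range q, (min t (insertBreak a (q + 1) b (k + 1)) -
      min t (insertBreak a (q + 1) b k)) • (if k + 1 ≤ q + 1 then x (k + 1) else x (k + 1 - 1)) =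
      (min t (a (k + 1)) - min t (a k)) • x (k + 1) := by
    intro k hk
    have hk := Finset.mem_range.1 hk
    rw [insertBreak_of_lt b (by omega), insertBreak_of_lt b (by omega), if_pos (by omega)]
  have h2 : ∀ k ∈ Finset.range r, (min t (insertBreak a (q + 1) b (q + 1 + 1 + k + 1)) -
      min t (insertBreak a (q + 1) b (q + 1 + 1 + k))) •
        (if q + 1 + 1 + k + 1 ≤ q + 1 then x (q + 1 + 1 + k + 1)
          else x (q + 1 + 1 + k + 1 - 1)) =
      (min t (a (q + 1 + k + 1)) - min t (a (q + 1 + k))) • x (q + 1 + k + 1) := by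
    intro k _
    rw [if_neg (by omega), show q + 1 + 1 + k = q + 1 + k + 1 by omega,
      insertBreak_succ b hp1 (by omega), insertBreak_succ b hp1 (by omega), Nat.add_sub_cancel]
  rw [Finset.sum_congr rfl h1, Finset.sum_congr rfl h2, insertBreak_of_lt b (Nat.lt_succ_self q),
    insertBreak_self b hp1, insertBreak_succ b hp1 le_rfl, if_pos le_rfl, if_neg (by omega),
    Nat.add_sub_cancel]
  module

end Paths

end GKM

namespace GKM

section ImaginaryOperator

variable {I V : Type*} [AddCommGroup V] [Module ℚ V] {A : I → I → ℤ} {α : I → V}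
  {coroot δ : I → (V →ₗ[ℚ] ℚ)} {lam : V} {s : ℕ} {x : ℕ → V} {a : ℕ → ℚ} {i : I} {tp tm : ℚ} {p : ℕ}

namespace IsGLS

theorem le_succ (hgls : IsGLS A α coroot lam s x a) : ∀ k < s, a k ≤ a (k + 1) :=
  fun k hk => (hgls.2.2.2.1 k hk).le

theorem pos (hgls : IsGLS A α coroot lam s x a) {k : ℕ} (hk : 1 ≤ k) (hks : k ≤ s) : 0 < a k := by
  have h1 := hgls.2.2.2.1 0 (by omega)
  rw [hgls.2.1] at h1
  exact h1.trans_le (le_of_succ_le hgls.le_succ hk hks)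

theorem coroot_nonneg (hgls : IsGLS A α coroot lam s x a) (h : IsRealization A A α coroot δ)
    (hdiag : ∀ i, A i i = 2 ∨ A i i ≤ 0) (hlam : lam ∈ Pplus coroot) (hi : A i i ≤ 0) {k : ℕ}
    (hk : k < s) : 0 ≤ coroot i (x (k + 1)) :=
  h.nonneg_of_mem_Torbit hdiag hlam (hgls.2.2.2.2.1 (k + 1) (by omega) hk) hi

theorem coroot_antitone (hgls : IsGLS A α coroot lam s x a) (h : IsRealization A A α coroot δ)
    (hi : A i i ≤ 0) {k l : ℕ} (hk : 1 ≤ k) (hkl : k ≤ l) (hl : l ≤ s) :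
    coroot i (x l) ≤ coroot i (x k) := by
  induction l, hkl using Nat.le_induction with
  | base => exact le_rfl
  | succ l hkl ih =>
    exact ((hgls.2.2.2.2.2.1 l (by omega) (by omega)).coroot_le h hi).trans (ih (by omega))

theorem hFun_eq (i : I) (t : ℚ) :
    hFun coroot i (glsPath x a s) t = glsPath (fun k => coroot i (x k)) a s t :=
  map_glsPath (coroot i)

theorem hFun_mono (hgls : IsGLS A α coroot lam s x a) (h : IsRealization A A α coroot δ)
    (hdiag : ∀ i, A i i = 2 ∨ A i i ≤ 0) (hlam : lam ∈ Pplus coroot) (hi : A i i ≤ 0) :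
    Monotone (hFun coroot i (glsPath x a s)) := fun t t' htt' => by
  rw [hFun_eq, hFun_eq]
  exact glsPath_mono (fun k hk => hgls.coroot_nonneg h hdiag hlam hi hk) htt'

theorem hFun_zero (hgls : IsGLS A α coroot lam s x a) (i : I) :
    hFun coroot i (glsPath x a s) 0 = 0 := by
  rw [hFun_eq]
  exact glsPath_zero fun k hk => hgls.2.1 ▸ le_of_succ_le hgls.le_succ (Nat.zero_le k) hk.le

theorem mOf_eq_zero (hgls : IsGLS A α coroot lam s x a) (h : IsRealization A A α coroot δ)
    (hdiag : ∀ i, A i i = 2 ∨ A i i ≤ 0) (hlam : lam ∈ Pplus coroot) (hi : A i i ≤ 0) :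
    mOf coroot i (glsPath x a s) = 0 := by
  refine IsLeast.csInf_eq ⟨⟨0, le_rfl, zero_le_one, by simp [hgls.hFun_zero i]⟩, ?_⟩
  rintro n ⟨t, ht, -, hn⟩
  have := hgls.hFun_mono h hdiag hlam hi ht
  rw [hgls.hFun_zero, hn] at this
  exact_mod_cast this

theorem fPlus_eq_zero (hgls : IsGLS A α coroot lam s x a) (h : IsRealization A A α coroot δ)
    (hdiag : ∀ i, A i i = 2 ∨ A i i ≤ 0) (hlam : lam ∈ Pplus coroot) (hi : A i i ≤ 0)
    (hfp : IsFPlus coroot i (glsPath x a s) tp) (hnz : tp < 1) : tp = 0 := by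
  obtain ⟨h0, -, hval, hmax⟩ := hfp
  rw [hgls.mOf_eq_zero h hdiag hlam hi, Int.cast_zero] at hval hmax
  by_contra hne
  have hpos : 0 < tp := lt_of_le_of_ne h0 (Ne.symm hne)
  have ha1 := hgls.pos le_rfl hgls.1
  have hmin : 0 < min tp (a 1) := lt_min hpos ha1
  have hslope : glsPath (fun k => coroot i (x k)) a s (min tp (a 1)) =
      min tp (a 1) * coroot i (x 1) :=
    glsPath_eq_mul hgls.le_succ hgls.2.1 hgls.1 (fun k hk => by
      obtain rfl : k = 0 := by omega
      rfl) hmin.le (min_le_right _ _)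
  have hle := hgls.hFun_mono h hdiag hlam hi (min_le_left tp (a 1))
  rw [hval, hFun_eq, hslope] at hle
  have hx1 : coroot i (x 1) ≤ 0 := by
    by_contra! hc
    exact absurd (mul_pos hmin hc) hle.not_gt
  refine absurd (hmax 1 zero_le_one le_rfl ?_) hnz.not_ge
  rw [hFun_eq, glsPath_eq_mul hgls.le_succ hgls.2.1 le_rfl (c := 0) ?_ zero_le_one hgls.2.2.1.ge,
    mul_zero]
  exact fun k hk => le_antisymm
    ((hgls.coroot_antitone h hi le_rfl (by omega) hk).trans hx1)
    (hgls.coroot_nonneg h hdiag hlam hi hk)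

theorem mul_coroot_lt_one (hgls : IsGLS A α coroot lam s x a) (h : IsRealization A A α coroot δ)
    (hdiag : ∀ i, A i i = 2 ∨ A i i ≤ 0) (hlam : lam ∈ Pplus coroot) (hi : A i i ≤ 0)
    (hfm : IsFMinus coroot i (glsPath x a s) 0 tm) {j : ℕ} (hj : 1 ≤ j) (hjs : j ≤ s)
    (hjm : a j < tm) : a j * coroot i (x j) < 1 := by
  obtain ⟨-, hm1, hval, hmin⟩ := hfm
  rw [hgls.mOf_eq_zero h hdiag hlam hi, Int.cast_zero, zero_add] at hval hmin
  have hle : a j * coroot i (x j) ≤ hFun coroot i (glsPath x a s) (a j) := by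
    rw [hFun_eq]
    exact mul_le_glsPath (u := fun k => coroot i (x k)) hgls.le_succ hgls.2.1 hjs
      fun k hk => hgls.coroot_antitone h hi (by omega) hk hjs
  refine lt_of_le_of_lt hle (lt_of_le_of_ne ?_ fun heq => ?_)
  · rw [← hval]
    exact hgls.hFun_mono h hdiag hlam hi hjm.le
  · exact absurd (hmin (a j) (hgls.pos hj hjs).le (hjm.le.trans hm1) heq) hjm.not_ge

theorem coroot_eq (hgls : IsGLS A α coroot lam s x a) (h : IsRealization A A α coroot δ)
    (hdiag : ∀ i, A i i = 2 ∨ A i i ≤ 0) (hlam : lam ∈ Pplus coroot) (hi : A i i ≤ 0)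
    (hfm : IsFMinus coroot i (glsPath x a s) 0 tm) (hp2 : p ≤ s) (hpm : a (p - 1) < tm) {j : ℕ}
    (hj : 1 ≤ j) (hjp : j < p) : coroot i (x j) = coroot i (x (j + 1)) :=
  (hgls.2.2.2.2.2.1 j hj (by omega)).coroot_eq h hdiag hlam hi (hgls.pos hj (by omega))
    (hgls.mul_coroot_lt_one h hdiag hlam hi hfm hj (by omega)
      ((le_of_succ_le hgls.le_succ (by omega) (by omega)).trans_lt hpm))

theorem coroot_eq_last (hgls : IsGLS A α coroot lam s x a) (h : IsRealization A A α coroot δ)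
    (hdiag : ∀ i, A i i = 2 ∨ A i i ≤ 0) (hlam : lam ∈ Pplus coroot) (hi : A i i ≤ 0)
    (hfm : IsFMinus coroot i (glsPath x a s) 0 tm) (hp2 : p ≤ s) (hpm : a (p - 1) < tm) {j : ℕ}
    (hj : 1 ≤ j) (hjp : j ≤ p) : coroot i (x j) = coroot i (x p) := by
  induction hjp using Nat.decreasingInduction with
  | self => rfl
  | of_succ j hjp ih =>
    rw [hgls.coroot_eq h hdiag hlam hi hfm hp2 hpm hj hjp, ih (by omega)]

theorem mul_coroot_eq_one (hgls : IsGLS A α coroot lam s x a) (h : IsRealization A A α coroot δ)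
    (hdiag : ∀ i, A i i = 2 ∨ A i i ≤ 0) (hlam : lam ∈ Pplus coroot) (hi : A i i ≤ 0)
    (hfm : IsFMinus coroot i (glsPath x a s) 0 tm) (hp2 : p ≤ s)
    (hpm : a (p - 1) < tm) (hpm' : tm ≤ a p) : tm * coroot i (x p) = 1 := by
  rw [← glsPath_eq_mul (u := fun k => coroot i (x k)) hgls.le_succ hgls.2.1 hp2
    (fun k hk => hgls.coroot_eq_last h hdiag hlam hi hfm hp2 hpm (by omega) hk) hfm.1 hpm',
    ← hFun_eq, hfm.2.2.1, hgls.mOf_eq_zero h hdiag hlam hi]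
  simp

theorem fPath_eq (hgls : IsGLS A α coroot lam s x a) (h : IsRealization A A α coroot δ)
    (hdiag : ∀ i, A i i = 2 ∨ A i i ≤ 0) (hlam : lam ∈ Pplus coroot) (hi : A i i ≤ 0)
    (hfm : IsFMinus coroot i (glsPath x a s) 0 tm) (hp2 : p ≤ s)
    (hpm : a (p - 1) < tm) (hpm' : tm ≤ a p) {t : ℚ} (ht : 0 ≤ t) :
    fPath α coroot i 0 tm (glsPath x a s) t =
      glsPath x a s t - min t tm • coroot i (x p) • α i := by
  have h0 : glsPath x a s 0 = 0 := glsPath_zero fun k hk =>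
    hgls.2.1 ▸ le_of_succ_le hgls.le_succ (Nat.zero_le k) hk.le
  rw [fPath]
  split_ifs with ht0 htm
  · obtain rfl : t = 0 := le_antisymm ht0 ht
    rw [min_eq_left hfm.1, zero_smul, sub_zero]
  · rw [h0, zero_add, sub_zero, srefl_apply, min_eq_left htm, smul_smul, map_glsPath,
      glsPath_eq_mul hgls.le_succ hgls.2.1 hp2
        (fun k hk => hgls.coroot_eq_last h hdiag hlam hi hfm hp2 hpm (by omega) hk) ht
        (htm.trans hpm')]
  · rw [min_eq_right (not_le.1 htm).le, smul_smul,
      hgls.mul_coroot_eq_one h hdiag hlam hi hfm hp2 hpm hpm', one_smul]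

theorem pathEq_insertBreak (hgls : IsGLS A α coroot lam s x a) (h : IsRealization A A α coroot δ)
    (hdiag : ∀ i, A i i = 2 ∨ A i i ≤ 0) (hlam : lam ∈ Pplus coroot) (hi : A i i ≤ 0)
    (hfm : IsFMinus coroot i (glsPath x a s) 0 tm) (hp1 : 1 ≤ p) (hp2 : p ≤ s)
    (hpm : a (p - 1) < tm) (hpm' : tm ≤ a p) :
    pathEq (fPath α coroot i 0 tm (glsPath x a s))
      (glsPath (fun k => if k ≤ p then srefl α coroot i (x k) else x (k - 1))
        (insertBreak a p tm) (s + 1)) := by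
  intro t ht _
  rw [hgls.fPath_eq h hdiag hlam hi hfm hp2 hpm hpm' ht,
    glsPath_shift (x := fun k => if k ≤ p then x k else x (k - 1)) (v := coroot i (x p) • α i)
      (insertBreak_le_succ hp1 hp2 hpm.le hpm' hgls.le_succ) ?_ (show p ≤ s + 1 by omega) ?_ ht,
    glsPath_insertBreak hp1 hp2 hpm.le hpm' hgls.le_succ, insertBreak_self tm hp1]
  · rw [insertBreak_of_lt tm hp1, hgls.2.1]
  · intro k _
    by_cases hk : k < p
    · rw [if_pos hk, if_pos (Nat.succ_le_of_lt hk), if_pos (Nat.succ_le_of_lt hk), srefl_apply,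
        hgls.coroot_eq_last h hdiag hlam hi hfm hp2 hpm (by omega) hk]
    · rw [if_neg hk, if_neg (by omega), if_neg (by omega)]

theorem isGLS_insertBreak (hgls : IsGLS A α coroot lam s x a) (h : IsRealization A A α coroot δ)
    (hdiag : ∀ i, A i i = 2 ∨ A i i ≤ 0) (hlam : lam ∈ Pplus coroot) (hi : A i i ≤ 0)
    (hfm : IsFMinus coroot i (glsPath x a s) 0 tm) (hp1 : 1 ≤ p) (hp2 : p ≤ s)
    (hpm : a (p - 1) < tm) (hpm' : tm < a p) :
    IsGLS A α coroot lam (s + 1) (fun k => if k ≤ p then srefl α coroot i (x k) else x (k - 1))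
        (insertBreak a p tm) := by
  have hone := hgls.mul_coroot_eq_one h hdiag hlam hi hfm hp2 hpm hpm'.le
  have hpos : 0 < coroot i (x p) := pos_of_mul_pos_right (by rw [hone]; exact one_pos) hfm.1
  obtain ⟨hs, ha0, has, hlt, horb, hchain, hend⟩ := id hgls
  refine ⟨by omega, ?_, ?_, insertBreak_le_succ hp1 hp2 hpm hpm' hlt, ?_, ?_, ?_⟩
  · rw [insertBreak_of_lt tm hp1, ha0]
  · rw [insertBreak_succ tm hp1 hp2, has]
  · intro k hk hks
    dsimp only
    split_ifs with hkp
    · exact IsRealization.srefl_mem_Torbit i (horb k hk (by omega))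
    · exact horb _ (by omega) (by omega)
  · intro k hk hks
    dsimp only
    rcases lt_trichotomy k p with hkp | rfl | hkp
    · rw [if_pos hkp.le, if_pos (Nat.succ_le_of_lt hkp), insertBreak_of_lt tm hkp]
      exact (hchain k hk (by omega)).map_srefl h hdiag hlam hi (hgls.pos hk (by omega))
        (hgls.mul_coroot_lt_one h hdiag hlam hi hfm hk (by omega)
          ((le_of_succ_le hgls.le_succ (by omega) (by omega)).trans_lt hpm))
    · rw [if_pos le_rfl, if_neg (by omega), insertBreak_self tm hp1, Nat.add_sub_cancel]
      exact HasAChain.cons_srefl h hi (horb k hk (by omega)) hpos hone (Or.inl rfl)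
    · obtain ⟨k, rfl⟩ : ∃ k', k = k' + 1 := ⟨k - 1, by omega⟩
      rw [if_neg (by omega), if_neg (by omega), insertBreak_succ tm hp1 (by omega)]
      exact hchain k (by omega) (by omega)
  · dsimp only
    rw [if_neg (by omega)]
    exact hend

theorem isGLS_reflect (hgls : IsGLS A α coroot lam s x a) (h : IsRealization A A α coroot δ)
    (hdiag : ∀ i, A i i = 2 ∨ A i i ≤ 0) (hlam : lam ∈ Pplus coroot) (hi : A i i ≤ 0)
    (hfm : IsFMinus coroot i (glsPath x a s) 0 (a p)) (hp1 : 1 ≤ p) (hp2 : p ≤ s)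
    (hpm : a (p - 1) < a p) :
    IsGLS A α coroot lam s (fun k => if k ≤ p then srefl α coroot i (x k) else x k) a := by
  have hone := hgls.mul_coroot_eq_one h hdiag hlam hi hfm hp2 hpm le_rfl
  have hpos : 0 < coroot i (x p) := pos_of_mul_pos_right (by rw [hone]; exact one_pos) hfm.1
  obtain ⟨hs, ha0, has, hlt, horb, hchain, hend⟩ := id hgls
  refine ⟨hs, ha0, has, hlt, ?_, ?_, ?_⟩
  · intro k hk hks
    dsimp only
    split_ifs with hkp
    · exact IsRealization.srefl_mem_Torbit i (horb k hk hks)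
    · exact horb k hk hks
  · intro k hk hks
    dsimp only
    rcases lt_trichotomy k p with hkp | rfl | hkp
    · rw [if_pos hkp.le, if_pos (Nat.succ_le_of_lt hkp)]
      exact (hchain k hk hks).map_srefl h hdiag hlam hi (hgls.pos hk hks.le)
        (hgls.mul_coroot_lt_one h hdiag hlam hi hfm hk hks.le
          ((le_of_succ_le hgls.le_succ (by omega) (by omega)).trans_lt hpm))
    · rw [if_pos le_rfl, if_neg (by omega)]
      exact HasAChain.cons_srefl h hi (horb k hk hp2) hpos hone (Or.inr (hchain k hk hks))
    · rw [if_neg (by omega), if_neg (by omega)]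
      exact hchain k hk hks
  · dsimp only
    rcases eq_or_lt_of_le hp2 with rfl | hps
    · rw [if_pos le_rfl]
      rw [has] at hone
      exact Or.inr (HasAChain.cons_srefl h hi (horb p hp1 le_rfl) hpos hone hend)
    · rw [if_neg (by omega)]
      exact hend

/-- For `i` imaginary, `f_i` maps GLS paths to GLS paths. -/
theorem exists_gls (hgls : IsGLS A α coroot lam s x a) (h : IsRealization A A α coroot δ)
    (hdiag : ∀ i, A i i = 2 ∨ A i i ≤ 0) (hlam : lam ∈ Pplus coroot) (hi : A i i ≤ 0)
    (hfm : IsFMinus coroot i (glsPath x a s) 0 tm) (hp1 : 1 ≤ p) (hp2 : p ≤ s)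
    (hpm : a (p - 1) < tm) (hpm' : tm ≤ a p) :
    ∃ ρ ∈ GLSset A α coroot lam, pathEq (fPath α coroot i 0 tm (glsPath x a s)) ρ := by
  rcases eq_or_lt_of_le hpm' with rfl | hlt
  · refine ⟨_, ⟨s, _, a, hgls.isGLS_reflect h hdiag hlam hi hfm hp1 hp2 hpm, rfl⟩, fun t ht _ => ?_⟩
    rw [hgls.fPath_eq h hdiag hlam hi hfm hp2 hpm le_rfl ht,
      glsPath_shift (x := x) (y := fun k => if k ≤ p then srefl α coroot i (x k) else x k)
        (v := coroot i (x p) • α i) hgls.le_succ hgls.2.1 hp2 ?_ ht]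
    intro k _
    by_cases hk : k < p
    · rw [if_pos hk, if_pos (Nat.succ_le_of_lt hk), srefl_apply,
        hgls.coroot_eq_last h hdiag hlam hi hfm hp2 hpm (by omega) hk]
    · rw [if_neg hk, if_neg (by omega)]
  · exact ⟨_, ⟨s + 1, _, _, hgls.isGLS_insertBreak h hdiag hlam hi hfm hp1 hp2 hpm hlt, rfl⟩,
      hgls.pathEq_insertBreak h hdiag hlam hi hfm hp1 hp2 hpm hlt.le⟩

theorem exists_segment (hgls : IsGLS A α coroot lam s x a) (h : IsRealization A A α coroot δ)
    (hdiag : ∀ i, A i i = 2 ∨ A i i ≤ 0) (hlam : lam ∈ Pplus coroot) (hi : A i i ≤ 0)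
    (hfm : IsFMinus coroot i (glsPath x a s) 0 tm) :
    ∃ p, 1 ≤ p ∧ p ≤ s ∧ a (p - 1) < tm ∧ tm ≤ a p := by
  classical
  have hex : ∃ p, tm ≤ a p := ⟨s, hgls.2.2.1 ▸ hfm.2.1⟩
  have hne : Nat.find hex ≠ 0 := by
    intro h0
    have h1 := Nat.find_spec hex
    rw [h0, hgls.2.1] at h1
    have h2 := hfm.2.2.1
    rw [le_antisymm h1 hfm.1, hgls.hFun_zero, hgls.mOf_eq_zero h hdiag hlam hi] at h2
    norm_num at h2
  exact ⟨Nat.find hex, by omega, Nat.find_le (hgls.2.2.1 ▸ hfm.2.1),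
    not_le.1 (Nat.find_min hex (by omega)), Nat.find_spec hex⟩

end IsGLS

end ImaginaryOperator

end GKM

open GKM in
/-- Action of `f_i`, `i` imaginary, on a GLS path `π = (λ_1, …, λ_s ; a_0, …, a_s)`
with `f_i π ≠ 0` (cutting data `t₊ = f_+^i(π)`, `t₋ = f_-^i(π)`, and `p` with
`a_{p-1} < t₋ ≤ a_p`): then `f_+^i(π) = 0`,
`f_i π = (r_i λ_1, …, r_i λ_p, λ_p, …, λ_s ; a_0, …, a_{p-1}, f_-^i(π), a_p, …, a_s)`,
`α_i^∨(λ_j) = α_i^∨(λ_{j+1})` for `1 ≤ j ≤ p-1`, the result (after dropping repeated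
terms) is again a GLS path, and `ℙ_λ` is stable under all `f_i`, `i` imaginary. -/
theorem stmt16 {I V : Type*} [Countable I] [AddCommGroup V] [Module ℚ V]
    (A : I → I → ℤ) (α : I → V) (coroot : I → (V →ₗ[ℚ] ℚ))
    (hind : LinearIndependent ℚ α)
    (hpair : ∀ i j, coroot i (α j) = (A i j : ℚ))
    (hdiag : ∀ i, A i i = 2 ∨ A i i ≤ 0)
    (hoff : ∀ i j, i ≠ j → A i j ≤ 0)
    (hzero : ∀ i j, A i j = 0 ↔ A j i = 0)
    (lam : V) (hlam : lam ∈ Pplus coroot)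
    (s : ℕ) (lamseq : ℕ → V) (a : ℕ → ℚ)
    (hgls : IsGLS A α coroot lam s lamseq a)
    (i : I) (hi : A i i ≠ 2)
    (tp : ℚ) (hfp : IsFPlus coroot i (glsPath lamseq a s) tp) (hnz : tp < 1)
    (tm : ℚ) (hfm : IsFMinus coroot i (glsPath lamseq a s) tp tm)
    (p : ℕ) (hp1 : 1 ≤ p) (hp2 : p ≤ s)
    (hpm : a (p - 1) < tm) (hpm' : tm ≤ a p) :
    tp = 0 ∧
    (∀ j : ℕ, 1 ≤ j → j < p →
      coroot i (lamseq j) = coroot i (lamseq (j + 1))) ∧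
    pathEq (fPath α coroot i tp tm (glsPath lamseq a s))
      (glsPath
        (fun k => if k ≤ p then srefl α coroot i (lamseq k) else lamseq (k - 1))
        (fun k => if k ≤ p - 1 then a k else if k = p then tm else a (k - 1))
        (s + 1)) ∧
    (∃ ρ ∈ GLSset A α coroot lam,
      pathEq (fPath α coroot i tp tm (glsPath lamseq a s)) ρ) ∧
    (∀ j : I, A j j ≠ 2 → ∀ σ ∈ GLSset A α coroot lam, ∀ σ' : ℚ → V,
      FRel α coroot j σ σ' → ∃ ρ ∈ GLSset A α coroot lam, pathEq σ' ρ) := by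
  obtain ⟨δ, hδ, hδ'⟩ := exists_coordinates hind
  have h : IsRealization A A α coroot δ := ⟨hpair, fun _ => rfl, fun _ _ => rfl, hoff,
    fun i j => (hzero i j).1, hδ, hδ'⟩
  have him : ∀ j, A j j ≠ 2 → A j j ≤ 0 := fun j hj => (hdiag j).resolve_left hj
  obtain rfl := hgls.fPlus_eq_zero h hdiag hlam (him i hi) hfp hnz
  refine ⟨rfl, fun j hj hjp => hgls.coroot_eq h hdiag hlam (him i hi) hfm hp2 hpm hj hjp,
    hgls.pathEq_insertBreak h hdiag hlam (him i hi) hfm hp1 hp2 hpm hpm',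
    hgls.exists_gls h hdiag hlam (him i hi) hfm hp1 hp2 hpm hpm', ?_⟩
  rintro j hj σ ⟨s, x, a, hσ, rfl⟩ σ' ⟨tp, tm, hfp, hnz, hfm, hσ'⟩
  obtain rfl := hσ.fPlus_eq_zero h hdiag hlam (him j hj) hfp hnz
  obtain ⟨p, hp1, hp2, hpm, hpm'⟩ := hσ.exists_segment h hdiag hlam (him j hj) hfm
  obtain ⟨ρ, hρ, hpath⟩ := hσ.exists_gls h hdiag hlam (him j hj) hfm hp1 hp2 hpm hpm'
  exact ⟨ρ, hρ, fun t ht ht' => (hσ' t ht ht').trans (hpath t ht ht')⟩
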